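/- arXiv:1902.05666 — 4 statements merged into one kernel-verified Lean document; each statement's English description precedes it below -/
import Mathlib

section
/- Let f ∈ ℤ[X] be a nonconstant separable polynomial (f has no repeated roots over ℚ). Assume the abc-conjecture. Then there exists a finite set S₀ of primes such that for every squarefree integer A > 1 having no prime factor in S₀, and every integer k coprime to A, there are infinitely many squarefree integers d with d ≡ k (mod A) such that there exist x, y ∈ ℚ with y ≠ 0 and d·y² = f(x). -/
/-- The radical of a natural number: the product of its distinct prime factors. -/
def Rad (m : ℕ) : ℕ := ∏ q ∈ m.primeFactors, q

/-- The abc-conjecture: for every `ε > 0` there is a constant `C > 0` such that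
`c ≤ C · rad(abc)^(1+ε)` for all coprime positive integers `a + b = c`. -/
def AbcConjecture : Prop :=
  ∀ ε : ℝ, 0 < ε → ∃ C : ℝ, 0 < C ∧ ∀ a b c : ℕ, 0 < a → 0 < b → 0 < c →
    Nat.Coprime a b → a + b = c → (c : ℝ) ≤ C * (Rad (a * b * c) : ℝ) ^ (1 + ε)

open Polynomial

theorem derivative_X_pow_card_sub_X (p : ℕ) [Fact p.Prime] :
    derivative (X ^ p - X : (ZMod p)[X]) = -1 := by
  rw [derivative_sub, derivative_X_pow, CharP.cast_eq_zero]
  simp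

theorem X_pow_card_sub_X_eq_prod (p : ℕ) [Fact p.Prime] :
    (X ^ p - X : (ZMod p)[X]) = ∏ a : ZMod p, (X - C a) := by
  have hdeg := FiniteField.X_pow_card_sub_X_natDegree_eq (ZMod p) (Fact.out : p.Prime).one_lt
  have hroots := FiniteField.roots_X_pow_card_sub_X (ZMod p)
  rw [ZMod.card] at hroots
  have hmonic : (X ^ p - X : (ZMod p)[X]).Monic := by
    refine monic_X_pow_sub ?_
    rw [degree_X]
    exact_mod_cast (Fact.out : p.Prime).one_lt
  have h := prod_multiset_X_sub_C_of_monic_of_roots_card_eq hmonic (by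
    rw [hroots, hdeg, Finset.card_val, Finset.card_univ, ZMod.card])
  rw [hroots] at h
  exact h.symm

/-- Coefficients of the expansion of `f ^ m` in powers of `X ^ p - X`, up to powers of `f`. -/
noncomputable def expansionCoeff {p : ℕ} [Fact p.Prime] (f : (ZMod p)[X]) (m : ℕ) (e : ZMod p) :
    ℕ → (ZMod p)[X]
  | 0 => C e
  | i + 1 => C (((i : ZMod p) + 1)⁻¹) *
      (f * derivative (expansionCoeff f m e i) -
        ((m + i : ℕ) : (ZMod p)[X]) * derivative f * expansionCoeff f m e i)

section Stepanov

variable {p : ℕ} [Fact p.Prime] {f : (ZMod p)[X]} {m : ℕ} {e : ZMod p}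

theorem natDegree_expansionCoeff_le (i : ℕ) :
    (expansionCoeff f m e i).natDegree ≤ i * f.natDegree := by
  induction i with
  | zero => simp [expansionCoeff]
  | succ i ih =>
    rw [expansionCoeff]
    refine (natDegree_C_mul_le _ _).trans ((natDegree_sub_le _ _).trans (max_le ?_ ?_))
    · refine natDegree_mul_le.trans ?_
      have := natDegree_derivative_le (expansionCoeff f m e i)
      rw [add_mul]; omega
    · rw [mul_assoc, ← C_eq_natCast]
      refine (natDegree_C_mul_le _ _).trans (natDegree_mul_le.trans ?_)
      have := natDegree_derivative_le f
      rw [add_mul]; omega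

theorem expansionCoeff_succ {i : ℕ} (hi : i + 1 < p) :
    ((i + 1 : ℕ) : (ZMod p)[X]) * expansionCoeff f m e (i + 1) =
      f * derivative (expansionCoeff f m e i) -
        ((m + i : ℕ) : (ZMod p)[X]) * derivative f * expansionCoeff f m e i := by
  have h0 : ((i + 1 : ℕ) : ZMod p) ≠ 0 := by
    rw [Ne, ZMod.natCast_eq_zero_iff]
    exact fun h => absurd (Nat.le_of_dvd (by omega) h) (by omega)
  rw [expansionCoeff, ← mul_assoc, ← C_eq_natCast, ← C_mul]
  have : ((i + 1 : ℕ) : ZMod p) * ((i : ZMod p) + 1)⁻¹ = 1 := by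
    push_cast at h0 ⊢
    exact mul_inv_cancel₀ h0
  rw [this, C_1, one_mul]

theorem expansionCoeff_mul_pow_succ {n i : ℕ} (hin : i < n) (hn : n < p) :
    ((i + 1 : ℕ) : (ZMod p)[X]) * f * (f ^ (n - (i + 1)) * expansionCoeff f m e (i + 1)) =
      f * derivative (f ^ (n - i) * expansionCoeff f m e i) -
        ((n + m : ℕ) : (ZMod p)[X]) * derivative f *
          (f ^ (n - i) * expansionCoeff f m e i) := by
  have h := expansionCoeff_succ (f := f) (m := m) (e := e) (i := i) (by omega)
  obtain ⟨j, rfl⟩ : ∃ j, n = i + 1 + j := ⟨n - (i + 1), by omega⟩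
  have h1 : i + 1 + j - (i + 1) = j := by omega
  have h2 : i + 1 + j - i = j + 1 := by omega
  rw [h1, h2, derivative_mul, derivative_pow]
  simp only [C_eq_natCast, Nat.add_sub_cancel]
  push_cast at h ⊢
  linear_combination (f ^ (j + 1)) * h

theorem expansion_ode {n k : ℕ} (hk : k ≤ n) (hn : n < p) :
    f * derivative (∑ i ∈ Finset.range (k + 1),
        f ^ (n - i) * expansionCoeff f m e i * (X ^ p - X) ^ i) -
      ((n + m : ℕ) : (ZMod p)[X]) * derivative f * ∑ i ∈ Finset.range (k + 1),
        f ^ (n - i) * expansionCoeff f m e i * (X ^ p - X) ^ i =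
    (X ^ p - X) ^ k * (f * derivative (f ^ (n - k) * expansionCoeff f m e k) -
        ((n + m : ℕ) : (ZMod p)[X]) * derivative f *
          (f ^ (n - k) * expansionCoeff f m e k)) := by
  induction k with
  | zero => simp
  | succ k ih =>
    have h := expansionCoeff_mul_pow_succ (f := f) (m := m) (e := e) (n := n) (i := k)
      (by omega) hn
    have ih := ih (by omega)
    rw [← h] at ih
    rw [Finset.sum_range_succ, derivative_add,
      derivative_mul (f := f ^ (n - (k + 1)) * expansionCoeff f m e (k + 1)),
      derivative_pow, derivative_X_pow_card_sub_X, C_eq_natCast, Nat.add_sub_cancel]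
    push_cast at ih ⊢
    linear_combination ih

theorem pow_dvd_of_dvd_ode {n N : ℕ} {E : (ZMod p)[X]} {a : ZMod p} (hn : n < p)
    (hfa : f.eval a ≠ 0) (hE : X - C a ∣ E)
    (hode : (X - C a) ^ n ∣ f * derivative E - (N : (ZMod p)[X]) * derivative f * E) :
    (X - C a) ^ (n + 1) ∣ E := by
  suffices h : ∀ k ≤ n, (X - C a) ^ (k + 1) ∣ E from h n le_rfl
  intro k
  induction k with
  | zero => simpa using hE
  | succ k ih =>
    intro hk
    obtain ⟨h, hh⟩ := ih (by omega)
    have h1 : (X - C a) ^ (k + 1) ∣ f * derivative E - (N : (ZMod p)[X]) * derivative f * E :=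
      (pow_dvd_pow _ hk).trans hode
    have h2 : (X - C a) ^ (k + 1) ∣ (X - C a) ^ k * (((k + 1 : ℕ) : (ZMod p)[X]) * f * h) := by
      have hd : derivative E = ((k + 1 : ℕ) : (ZMod p)[X]) * (X - C a) ^ k * h +
          (X - C a) ^ (k + 1) * derivative h := by
        rw [hh, derivative_mul, derivative_X_sub_C_pow, C_eq_natCast, Nat.add_sub_cancel]
      have : (X - C a) ^ k * (((k + 1 : ℕ) : (ZMod p)[X]) * f * h) =
          (f * derivative E - (N : (ZMod p)[X]) * derivative f * E) -
          (X - C a) ^ (k + 1) * (f * derivative h - (N : (ZMod p)[X]) * derivative f * h) := by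
        rw [hd, hh]; ring
      rw [this]
      exact dvd_sub h1 (dvd_mul_right _ _)
    rw [pow_succ] at h2
    have h3 := (mul_dvd_mul_iff_left (pow_ne_zero k (X_sub_C_ne_zero a))).1 h2
    rw [dvd_iff_isRoot, IsRoot.def, eval_mul, eval_mul, eval_natCast] at h3
    have h0 : ((k + 1 : ℕ) : ZMod p) ≠ 0 := by
      rw [Ne, ZMod.natCast_eq_zero_iff]
      exact fun h => absurd (Nat.le_of_dvd (by omega) h) (by omega)
    have h4 : h.eval a = 0 := by
      rcases mul_eq_zero.1 h3 with h5 | h5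
      · exact absurd h5 (mul_ne_zero h0 hfa)
      · exact h5
    rw [hh, pow_succ _ (k + 1)]
    exact mul_dvd_mul_left _ (dvd_iff_isRoot.2 h4)

theorem pow_dvd_of_mul_derivative_eq (hsep : IsCoprime f (derivative f)) {N : ℕ} (hN : N < p)
    {h : (ZMod p)[X]}
    (hode : f * derivative h = (N : (ZMod p)[X]) * derivative f * h) : f ^ N ∣ h := by
  induction N generalizing h with
  | zero => simp
  | succ N ih =>
    have h0 : ((N + 1 : ℕ) : ZMod p) ≠ 0 := by
      rw [Ne, ZMod.natCast_eq_zero_iff]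
      exact fun h => absurd (Nat.le_of_dvd (by omega) h) (by omega)
    have hu : IsUnit ((N + 1 : ℕ) : (ZMod p)[X]) := by
      rw [← C_eq_natCast]; exact isUnit_C.2 (isUnit_iff_ne_zero.2 h0)
    have h1 : f ∣ h := by
      have h2 : f ∣ ((N + 1 : ℕ) : (ZMod p)[X]) * (derivative f * h) :=
        ⟨_, by rw [hode]; ring⟩
      exact hsep.dvd_of_dvd_mul_left (hu.dvd_mul_left.1 h2)
    obtain ⟨g, rfl⟩ := h1
    by_cases hf : f = 0
    · simp [hf]
    rw [pow_succ']
    refine mul_dvd_mul_left _ (ih (by omega) (mul_left_cancel₀ hf ?_))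
    rw [derivative_mul] at hode
    push_cast at hode
    linear_combination hode

/-- A weak form of Weil's bound: powers of a separable polynomial of small degree are not
constant on the complement of its zero set. -/
theorem not_forall_eval_pow_eq (hdeg : 0 < f.natDegree) (hsep : IsCoprime f (derivative f))
    (hp : 2 * f.natDegree ^ 2 + 2 * f.natDegree < p) (hm : 0 < m) (hmp : 2 * m < p)
    (h : ∀ a, f.eval a = 0 ∨ f.eval a ^ m = e) : False := by
  set n := f.natDegree with hn
  have hf0 : f ≠ 0 := by rintro rfl; simp at hn; omega
  have hnp : n < p := by nlinarith
  have hypos : (X ^ p - X : (ZMod p)[X]).natDegree = p :=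
    FiniteField.X_pow_card_sub_X_natDegree_eq _ (Fact.out : p.Prime).one_lt
  have hy0 : (X ^ p - X : (ZMod p)[X]) ≠ 0 :=
    FiniteField.X_pow_card_sub_X_ne_zero _ (Fact.out : p.Prime).one_lt
  have hprod : (X ^ p - X : (ZMod p)[X]) = ∏ a : ZMod p, (X - C a) :=
    X_pow_card_sub_X_eq_prod p
  set g : ℕ → (ZMod p)[X] := fun i => f ^ (n - i) * expansionCoeff f m e i with hg
  have hgdeg : ∀ i ≤ n, (g i).natDegree ≤ n ^ 2 := by
    intro i hi
    refine natDegree_mul_le.trans ?_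
    have h1 := natDegree_pow_le (p := f) (n := n - i)
    have h2 := natDegree_expansionCoeff_le (f := f) (m := m) (e := e) i
    rw [← hn] at h1 h2
    have : (n - i) * n + i * n = n ^ 2 := by rw [← add_mul, Nat.sub_add_cancel hi, sq]
    omega
  set E : (ZMod p)[X] := f ^ (n + m) -
    ∑ i ∈ Finset.range (n + 1), g i * (X ^ p - X) ^ i with hE
  have hyeval : ∀ a : ZMod p, (X ^ p - X : (ZMod p)[X]).eval a = 0 := by
    intro a; simp [ZMod.pow_card]
  have hpowode : f * derivative (f ^ (n + m)) -
      ((n + m : ℕ) : (ZMod p)[X]) * derivative f * f ^ (n + m) = 0 := by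
    obtain ⟨k, hk⟩ : ∃ k, n + m = k + 1 := ⟨n + m - 1, by omega⟩
    rw [hk, derivative_pow, C_eq_natCast, Nat.add_sub_cancel]
    ring
  have hsumode := expansion_ode (f := f) (m := m) (e := e) (le_refl n) hnp
  have hEode : f * derivative E - ((n + m : ℕ) : (ZMod p)[X]) * derivative f * E =
      -((X ^ p - X) ^ n * (f * derivative (g n) -
        ((n + m : ℕ) : (ZMod p)[X]) * derivative f * g n)) := by
    rw [← hsumode, hE, derivative_sub]
    linear_combination hpowode
  have hEa : ∀ a, f.eval a ≠ 0 → E.eval a = 0 := by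
    intro a ha
    have h1 := (h a).resolve_left ha
    rw [hE, eval_sub, eval_finsetSum, Finset.sum_range_succ']
    simp only [eval_mul, eval_pow, hyeval, hg]
    simp [expansionCoeff, pow_add, h1]
  have hdvd : (X ^ p - X : (ZMod p)[X]) ^ (n + 1) ∣ f ^ (n + 1) * E := by
    rw [hprod, ← Finset.prod_pow]
    refine Finset.prod_dvd_of_coprime ?_ ?_
    · intro a _ b _ hab
      exact (pairwise_coprime_X_sub_C Function.injective_id hab).pow
    · intro a _
      by_cases ha : f.eval a = 0
      · exact (pow_dvd_pow_of_dvd (dvd_iff_isRoot.2 ha) _).mul_right _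
      · refine (pow_dvd_of_dvd_ode hnp ha (dvd_iff_isRoot.2 (hEa a ha)) (N := n + m) ?_).mul_left _
        rw [hEode, dvd_neg]
        exact (pow_dvd_pow_of_dvd (dvd_iff_isRoot.2 (hyeval a)) _).mul_right _
  have hEdeg : E.natDegree ≤ n ^ 2 + n * p := by
    refine (natDegree_sub_le _ _).trans (max_le ?_ ?_)
    · rw [natDegree_pow, ← hn]; nlinarith
    · refine natDegree_sum_le_of_forall_le _ _ ?_
      intro i hi
      rw [Finset.mem_range] at hi
      refine natDegree_mul_le.trans (add_le_add (hgdeg i (by omega)) ?_)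
      rw [natDegree_pow, hypos]
      exact Nat.mul_le_mul_right _ (by omega)
  have hE0 : E = 0 := by
    by_contra hne
    have h1 := natDegree_le_of_dvd hdvd (mul_ne_zero (pow_ne_zero _ hf0) hne)
    rw [natDegree_pow, hypos, natDegree_mul (pow_ne_zero _ hf0) hne, natDegree_pow, ← hn] at h1
    nlinarith
  have hcount : p ≤ n * (m + 1) := by
    by_contra hlt
    have h1 : f * (f ^ m - C e) = 0 := by
      refine eq_zero_of_natDegree_lt_card_of_eval_eq_zero' _ Finset.univ ?_ ?_
      · intro a _
        rcases h a with ha | ha <;> simp [ha]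
      · rw [Finset.card_univ, ZMod.card]
        refine lt_of_le_of_lt natDegree_mul_le ?_
        rw [natDegree_sub_C, natDegree_pow, ← hn]
        linarith
    have h2 := (mul_eq_zero.1 h1).resolve_left hf0
    have h3 : (f ^ m).natDegree = 0 := by rw [sub_eq_zero.1 h2, natDegree_C]
    rw [natDegree_pow, ← hn] at h3
    rcases Nat.mul_eq_zero.1 h3 with h4 | h4 <;> omega
  have hNp : n + m < p := by nlinarith
  have hvanish : ∀ i ≤ n, f * derivative (g i) =
      ((n + m : ℕ) : (ZMod p)[X]) * derivative f * g i → g i = 0 := by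
    intro i hi hode
    by_contra hne
    have h1 := natDegree_le_of_dvd (pow_dvd_of_mul_derivative_eq hsep hNp hode) hne
    rw [natDegree_pow, ← hn] at h1
    have := hgdeg i hi
    nlinarith
  have hall : ∀ j ≤ n, g (n - j) = 0 := by
    intro j
    induction j with
    | zero =>
      intro _
      refine hvanish n le_rfl ?_
      rw [hE0] at hEode
      simp only [derivative_zero, mul_zero, sub_zero] at hEode
      have := (mul_eq_zero.1 (neg_eq_zero.1 hEode.symm)).resolve_left (pow_ne_zero _ hy0)
      exact sub_eq_zero.1 this
    | succ j ih =>
      intro hj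
      refine hvanish _ (by omega) ?_
      have h1 := expansionCoeff_mul_pow_succ (f := f) (m := m) (e := e) (n := n)
        (i := n - (j + 1)) (by omega) hnp
      have h2 : n - (j + 1) + 1 = n - j := by omega
      have h3 := ih (by omega)
      simp only [hg] at h3
      rw [h2, h3, mul_zero] at h1
      exact (sub_eq_zero.1 h1.symm)
  have h0 := hall n le_rfl
  simp only [hg, Nat.sub_self, expansionCoeff, Nat.sub_zero] at h0
  have he : e = 0 := by
    rcases mul_eq_zero.1 h0 with h1 | h1
    · exact absurd h1 (pow_ne_zero _ hf0)
    · simpa using h1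
  have h1 : ∀ a, f.eval a = 0 := by
    intro a
    rcases h a with ha | ha
    · exact ha
    · rw [he] at ha; exact eq_zero_of_pow_eq_zero ha
  refine hf0 (eq_zero_of_natDegree_lt_card_of_eval_eq_zero' _ Finset.univ (fun a _ => h1 a) ?_)
  rw [Finset.card_univ, ZMod.card]
  exact hnp

end Stepanov

section Belyi

/-- The critical values of a rational polynomial are the roots of a rational polynomial of
smaller degree. -/
theorem exists_criticalValues (Q : ℚ[X]) (hQ : 0 < Q.natDegree) :
    ∃ G : ℚ[X], G ≠ 0 ∧ G.natDegree ≤ Q.natDegree - 1 ∧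
      ∀ z : ℂ, aeval z (derivative Q) = 0 → aeval (aeval z Q) G = 0 := by
  have hQ' : derivative Q ≠ 0 := by
    intro h
    exact hQ.ne' (derivative_eq_zero.1 h)
  let pb := AdjoinRoot.powerBasis hQ'
  have : Module.Finite ℚ (AdjoinRoot (derivative Q)) := pb.finite
  refine ⟨minpoly ℚ (AdjoinRoot.mk (derivative Q) Q), ?_, ?_, ?_⟩
  · exact minpoly.ne_zero (Algebra.IsIntegral.isIntegral _)
  · refine (minpoly.natDegree_le _).trans ?_
    rw [pb.finrank, AdjoinRoot.powerBasis_dim]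
    exact natDegree_derivative_le Q
  · intro z hz
    have h := minpoly.aeval ℚ (AdjoinRoot.mk (derivative Q) Q)
    have h2 : aeval (aeval z Q) (minpoly ℚ (AdjoinRoot.mk (derivative Q) Q)) =
        AdjoinRoot.liftAlgHom (derivative Q) (Algebra.ofId ℚ ℂ) z hz
          (aeval (AdjoinRoot.mk (derivative Q) Q) (minpoly ℚ (AdjoinRoot.mk (derivative Q) Q))) := by
      rw [← aeval_algHom_apply]
      congr 1
    rw [h2, h, map_zero]

theorem aeval_derivative_comp_eq_zero {g h : ℚ[X]} {z : ℂ}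
    (hz : aeval z (derivative (h.comp g)) = 0) :
    aeval z (derivative g) = 0 ∨ aeval (aeval z g) (derivative h) = 0 := by
  rw [derivative_comp, map_mul, aeval_comp] at hz
  exact mul_eq_zero.1 hz

theorem exists_rational_criticalValues (n : ℕ) : ∀ (Q : ℚ[X]) (C : Finset ℚ), Q ≠ 0 →
    Q.natDegree ≤ n → ∃ (h : ℚ[X]) (C' : Finset ℚ), 0 < h.natDegree ∧
      (∀ c ∈ C, h.eval c ∈ C') ∧
      ∀ z : ℂ, aeval z Q = 0 ∨ aeval z (derivative h) = 0 → ∃ c ∈ C', aeval z h = (c : ℂ) := by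
  induction n with
  | zero =>
    intro Q C hQ hdeg
    refine ⟨X, C, by simp, by simp, ?_⟩
    rintro z (hz | hz)
    · rw [eq_C_of_natDegree_eq_zero (Nat.le_zero.1 hdeg), aeval_C] at hz
      have := (map_eq_zero _).1 hz
      exact absurd (by rw [eq_C_of_natDegree_eq_zero (Nat.le_zero.1 hdeg), this, C_0]) hQ
    · simp at hz
  | succ n ih =>
    intro Q C hQ hdeg
    rcases Nat.eq_zero_or_pos Q.natDegree with h0 | hpos
    · exact ih Q C hQ (by omega)
    obtain ⟨G, hG0, hGdeg, hG⟩ := exists_criticalValues Q hpos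
    obtain ⟨h, C', hh, hC, hz⟩ := ih G (insert 0 (C.image fun c => Q.eval c)) hG0 (by omega)
    refine ⟨h.comp Q, C', ?_, ?_, ?_⟩
    · rw [natDegree_comp]; exact Nat.mul_pos hh hpos
    · intro c hc
      rw [eval_comp]
      exact hC _ (Finset.mem_insert_of_mem (Finset.mem_image_of_mem _ hc))
    · intro z hor
      rw [aeval_comp]
      rcases hor with hQz | hd
      · refine ⟨h.eval 0, hC 0 (Finset.mem_insert_self _ _), ?_⟩
        rw [hQz, ← map_zero (algebraMap ℚ ℂ), aeval_algebraMap_apply]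
        simp
      · rcases aeval_derivative_comp_eq_zero hd with h1 | h1
        · exact hz _ (Or.inl (hG z h1))
        · exact hz _ (Or.inr h1)

/-- Belyi's polynomial sending three given rational points to `0`, `1`, `0`. -/
theorem exists_belyi_polynomial_of_three_points {u w v : ℚ} (huw : u < w) (hwv : w < v) :
    ∃ h : ℚ[X], 0 < h.natDegree ∧ h.eval u = 0 ∧ h.eval v = 0 ∧ h.eval w = 1 ∧
      ∀ z : ℂ, aeval z (derivative h) = 0 → z = u ∨ z = v ∨ z = w := by
  obtain ⟨a, b, ha, hb, hab⟩ : ∃ a b : ℕ, 0 < a ∧ 0 < b ∧ (a : ℚ) * (v - w) = b * (w - u) := by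
    have hr : 0 < (w - u) / (v - w) := div_pos (by linarith) (by linarith)
    refine ⟨((w - u) / (v - w)).num.toNat, ((w - u) / (v - w)).den, ?_,
      ((w - u) / (v - w)).den_pos, ?_⟩
    · have := Rat.num_pos.2 hr; omega
    · have h1 : ((((w - u) / (v - w)).num.toNat : ℕ) : ℚ) = (((w - u) / (v - w)).num : ℚ) := by
        have := Rat.num_pos.2 hr
        rw [← Int.cast_natCast, Int.toNat_of_nonneg this.le]
      have h2 := Rat.num_div_den ((w - u) / (v - w))
      have h3 : (((w - u) / (v - w)).den : ℚ) ≠ 0 := by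
        exact_mod_cast ((w - u) / (v - w)).den_pos.ne'
      have h4 : v - w ≠ 0 := by linarith
      rw [h1]
      rw [div_eq_div_iff h3 h4] at h2
      linarith
  obtain ⟨a, rfl⟩ : ∃ a', a = a' + 1 := ⟨a - 1, by omega⟩
  obtain ⟨b, rfl⟩ : ∃ b', b = b' + 1 := ⟨b - 1, by omega⟩
  set κ : ℚ := ((w - u) ^ (a + 1) * (w - v) ^ (b + 1))⁻¹ with hκ
  have hk0 : (w - u) ^ (a + 1) * (w - v) ^ (b + 1) ≠ 0 :=
    mul_ne_zero (pow_ne_zero _ (by linarith)) (pow_ne_zero _ (by linarith))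
  have hκ0 : κ ≠ 0 := inv_ne_zero hk0
  refine ⟨C κ * ((X - C u) ^ (a + 1) * (X - C v) ^ (b + 1)), ?_, by simp, by simp, ?_, ?_⟩
  · rw [natDegree_C_mul hκ0, natDegree_mul (pow_ne_zero _ (X_sub_C_ne_zero _))
      (pow_ne_zero _ (X_sub_C_ne_zero _)), natDegree_pow, natDegree_X_sub_C]
    omega
  · simp only [eval_mul, eval_C, eval_pow, eval_sub, eval_X]
    exact inv_mul_cancel₀ hk0
  · intro z hz
    have hd : derivative (C κ * ((X - C u) ^ (a + 1) * (X - C v) ^ (b + 1))) =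
        C κ * ((X - C u) ^ a * (X - C v) ^ b * (C ((a : ℚ) + 1 + (b + 1)) * (X - C w))) := by
      have h5 : ((a : ℚ) + 1) * v + (b + 1) * u = (a + 1 + (b + 1)) * w := by
        push_cast at hab; linarith
      have h6 : C ((a : ℚ) + 1) * C v + C ((b : ℚ) + 1) * C u =
          C ((a : ℚ) + 1 + (b + 1)) * C w := by
        rw [← C_mul, ← C_mul, ← C_mul, ← C_add, h5]
      rw [derivative_C_mul, derivative_mul, derivative_X_sub_C_pow, derivative_X_sub_C_pow]
      push_cast
      simp only [map_add, map_one] at h6 ⊢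
      linear_combination (-(C κ * (X - C u) ^ a * (X - C v) ^ b)) * h6
    rw [hd] at hz
    simp only [map_mul, map_pow, map_sub, aeval_X, aeval_C, mul_eq_zero,
      pow_eq_zero_iff', sub_eq_zero, eq_ratCast, Rat.cast_eq_zero] at hz
    have h7 : (a : ℚ) + 1 + (b + 1) ≠ 0 := by positivity
    rcases hz with h | (h | h) | h | h
    · exact absurd h hκ0
    · exact Or.inl h.1
    · exact Or.inr (Or.inl h.1)
    · exact absurd h h7
    · exact Or.inr (Or.inr h)

theorem exists_belyi_polynomial_of_rational (n : ℕ) : ∀ C : Finset ℚ, C.card ≤ n →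
    ∃ h : ℚ[X], 0 < h.natDegree ∧ (∀ c ∈ C, h.eval c = 0 ∨ h.eval c = 1) ∧
      ∀ z : ℂ, aeval z (derivative h) = 0 → aeval z h = 0 ∨ aeval z h = 1 := by
  have hsmall : ∀ u v : ℚ, u ≠ v → ∃ h : ℚ[X], 0 < h.natDegree ∧
      (∀ c ∈ ({u, v} : Finset ℚ), h.eval c = 0 ∨ h.eval c = 1) ∧
      ∀ z : ℂ, aeval z (derivative h) = 0 → aeval z h = 0 ∨ aeval z h = 1 := by
    intro u v huv
    have h0 : v - u ≠ 0 := sub_ne_zero.2 huv.symm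
    refine ⟨C (v - u)⁻¹ * (X - C u), ?_, ?_, ?_⟩
    · rw [natDegree_C_mul (inv_ne_zero h0), natDegree_X_sub_C]; exact one_pos
    · intro c hc
      simp only [Finset.mem_insert, Finset.mem_singleton] at hc
      rcases hc with rfl | rfl
      · simp
      · right; simp [h0]
    · intro z hz
      rw [derivative_C_mul, derivative_X_sub_C, mul_one, aeval_C, map_eq_zero] at hz
      exact absurd hz (inv_ne_zero h0)
  induction n with
  | zero =>
    intro C hC
    obtain ⟨h, h1, -, h3⟩ := hsmall 0 1 zero_ne_one
    refine ⟨h, h1, ?_, h3⟩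
    rw [Finset.card_eq_zero.1 (Nat.le_zero.1 hC)]
    simp
  | succ n ih =>
    intro C hC
    by_cases hle : C.card ≤ 2
    · obtain ⟨u, v, huv, hsub⟩ : ∃ u v : ℚ, u ≠ v ∧ C ⊆ {u, v} := by
        have h01 : ∃ D : Finset ℚ, C ⊆ D ∧ D.card = 2 :=
          Infinite.exists_superset_card_eq C 2 hle
        obtain ⟨D, hCD, hD⟩ := h01
        obtain ⟨u, v, huv, rfl⟩ := Finset.card_eq_two.1 hD
        exact ⟨u, v, huv, hCD⟩
      obtain ⟨h, h1, h2, h3⟩ := hsmall u v huv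
      exact ⟨h, h1, fun c hc => h2 c (hsub hc), h3⟩
    · obtain ⟨u, w, v, hu, hw, hv, huw, hwv⟩ : ∃ u w v : ℚ, u ∈ C ∧ w ∈ C ∧ v ∈ C ∧
          u < w ∧ w < v := by
        let e := C.orderEmbOfFin rfl
        refine ⟨e ⟨0, by omega⟩, e ⟨1, by omega⟩, e ⟨2, by omega⟩, C.orderEmbOfFin_mem rfl _,
          C.orderEmbOfFin_mem rfl _, C.orderEmbOfFin_mem rfl _, ?_, ?_⟩
        · exact e.strictMono (by simp)
        · exact e.strictMono (by simp)
      obtain ⟨g, hg, hgu, hgv, hgw, hgz⟩ := exists_belyi_polynomial_of_three_points huw hwv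
      have hcard : (C.image fun c => g.eval c).card ≤ n := by
        have h1 : (C.image fun c => g.eval c) = (C.erase u).image fun c => g.eval c := by
          ext y
          simp only [Finset.mem_image, Finset.mem_erase]
          constructor
          · rintro ⟨c, hc, rfl⟩
            by_cases hcu : c = u
            · exact ⟨v, ⟨by intro h; linarith, hv⟩, by rw [hcu, hgu, hgv]⟩
            · exact ⟨c, ⟨hcu, hc⟩, rfl⟩
          · rintro ⟨c, hc, rfl⟩
            exact ⟨c, hc.2, rfl⟩
        rw [h1]
        refine Finset.card_image_le.trans ?_
        rw [Finset.card_erase_of_mem hu]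
        omega
      obtain ⟨h, h1, h2, h3⟩ := ih _ hcard
      refine ⟨h.comp g, ?_, ?_, ?_⟩
      · rw [natDegree_comp]; exact Nat.mul_pos h1 hg
      · intro c hc
        rw [eval_comp]
        exact h2 _ (Finset.mem_image_of_mem _ hc)
      · intro z hz
        rw [aeval_comp]
        rcases aeval_derivative_comp_eq_zero hz with h4 | h4
        · have key : ∀ c ∈ C, z = (c : ℂ) → aeval (aeval z g) h = 0 ∨ aeval (aeval z g) h = 1 := by
            rintro c hc rfl
            have h5 : aeval (aeval (c : ℂ) g) h = ((h.eval (g.eval c) : ℚ) : ℂ) := by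
              rw [← eq_ratCast (algebraMap ℚ ℂ) c, aeval_algebraMap_apply, aeval_algebraMap_apply]
              simp
            rw [h5]
            exact_mod_cast h2 _ (Finset.mem_image_of_mem _ hc)
          rcases hgz z h4 with h5 | h5 | h5
          · exact key u hu h5
          · exact key v hv h5
          · exact key w hw h5
        · exact h3 _ h4

theorem exists_belyi_polynomial (F : ℚ[X]) (hF : F ≠ 0) :
    ∃ φ : ℚ[X], 0 < φ.natDegree ∧
      ∀ z : ℂ, aeval z F = 0 ∨ aeval z (derivative φ) = 0 → aeval z φ = 0 ∨ aeval z φ = 1 := by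
  obtain ⟨g, C, hg, -, hgz⟩ := exists_rational_criticalValues _ F ∅ hF le_rfl
  obtain ⟨h, hh, hC, hhz⟩ := exists_belyi_polynomial_of_rational _ C le_rfl
  refine ⟨h.comp g, ?_, ?_⟩
  · rw [natDegree_comp]; exact Nat.mul_pos hh hg
  · have key : ∀ z : ℂ, aeval z F = 0 ∨ aeval z (derivative g) = 0 →
        aeval z (h.comp g) = 0 ∨ aeval z (h.comp g) = 1 := by
      intro z hz
      obtain ⟨c, hc, hcz⟩ := hgz z hz
      have h5 : aeval (c : ℂ) h = ((h.eval c : ℚ) : ℂ) := by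
        rw [← eq_ratCast (algebraMap ℚ ℂ) c, aeval_algebraMap_apply]
        simp
      rw [aeval_comp, hcz, h5]
      exact_mod_cast hC c hc
    rintro z (hz | hz)
    · exact key z (Or.inl hz)
    · rcases aeval_derivative_comp_eq_zero hz with h4 | h4
      · exact key z (Or.inr h4)
      · rw [aeval_comp]; exact hhz _ h4

/-- A Belyi polynomial `φ` for `F`, together with the Riemann–Hurwitz count: `F * S` has the
same roots as `φ * (φ - 1)`, each with multiplicity one. -/
theorem exists_belyi_factorization (F : ℚ[X]) (hF : F.Separable) :
    ∃ (φ S : ℚ[X]) (b : ℕ), 0 < φ.natDegree ∧ φ * (φ - 1) = F * S * derivative φ ∧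
      φ * (φ - 1) ∣ (F * S) ^ b := by
  have hF0 : F ≠ 0 := hF.ne_zero
  obtain ⟨φ, hφ, hz⟩ := exists_belyi_polynomial F hF0
  have hφ' : derivative φ ≠ 0 := fun h => hφ.ne' (derivative_eq_zero.1 h)
  have hφ0 : φ ≠ 0 := by rintro rfl; simp at hφ
  have hφ1 : φ - 1 ≠ 0 := by
    intro h; rw [sub_eq_zero.1 h] at hφ; simp at hφ
  let ι := algebraMap ℚ ℂ
  have hinj : Function.Injective ι := ι.injective
  have hm : ∀ {P : ℚ[X]}, P ≠ 0 → P.map ι ≠ 0 := fun h => (Polynomial.map_ne_zero_iff hinj).2 h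
  have hroot : ∀ (P : ℚ[X]) (t : ℂ), aeval t P = 0 ↔ (P.map ι).IsRoot t := fun P t => by
    rw [IsRoot.def, eval_map_algebraMap]
  have hmult : ∀ t : ℂ, aeval t (φ * (φ - 1)) = 0 →
      ((derivative φ).map ι).rootMultiplicity t + 1 =
        ((φ * (φ - 1)).map ι).rootMultiplicity t := by
    have key : ∀ (P R : ℚ[X]) (t : ℂ), P ≠ 0 → R ≠ 0 → aeval t P = 0 → aeval t R ≠ 0 →
        ((derivative P).map ι).rootMultiplicity t + 1 =
          ((P * R).map ι).rootMultiplicity t := by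
      intro P R t hP hR hPt hRt
      have h1 := derivative_rootMultiplicity_of_root ((hroot P t).1 hPt)
      have h2 := (rootMultiplicity_pos (hm hP)).2 ((hroot P t).1 hPt)
      have h3 := rootMultiplicity_eq_zero (fun h => hRt ((hroot R t).2 h))
      rw [Polynomial.map_mul, rootMultiplicity_mul (mul_ne_zero (hm hP) (hm hR)), h3,
        ← derivative_map, h1]
      omega
    intro t ht
    rw [map_mul, mul_eq_zero] at ht
    rcases ht with h | h
    · exact key φ (φ - 1) t hφ0 hφ1 h (by simp [h])
    · have h2 : aeval t φ = 1 := by simpa [sub_eq_zero] using h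
      have := key (φ - 1) φ t hφ1 hφ0 h (by simp [h2])
      rwa [mul_comm (φ - 1), derivative_sub, derivative_one, sub_zero] at this
  have hW0 : φ * (φ - 1) ≠ 0 := mul_ne_zero hφ0 hφ1
  have hdvd : F * derivative φ ∣ φ * (φ - 1) := by
    rw [← map_dvd_map' ι, IsAlgClosed.dvd_iff_roots_le_roots (hm (mul_ne_zero hF0 hφ')) (hm hW0),
      Multiset.le_iff_count]
    intro t
    rw [count_roots, count_roots, Polynomial.map_mul,
      rootMultiplicity_mul (mul_ne_zero (hm hF0) (hm hφ'))]
    by_cases ht : aeval t (φ * (φ - 1)) = 0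
    · rw [← hmult t ht]
      have := rootMultiplicity_le_one_of_separable (hF.map (f := ι)) t
      omega
    · have h1 : ¬ (aeval t F = 0 ∨ aeval t (derivative φ) = 0) := by
        intro h
        apply ht
        rcases hz t h with h | h <;> simp [h]
      rw [not_or] at h1
      rw [rootMultiplicity_eq_zero (fun h => h1.1 ((hroot _ t).2 h)),
        rootMultiplicity_eq_zero (fun h => h1.2 ((hroot _ t).2 h))]
      exact Nat.zero_le _
  obtain ⟨S, hS⟩ := hdvd
  have hS0 : S ≠ 0 := by rintro rfl; rw [mul_zero] at hS; exact hW0 hS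
  have hFS : F * S ≠ 0 := mul_ne_zero hF0 hS0
  have hS' : φ * (φ - 1) = F * S * derivative φ := by rw [hS]; ring
  refine ⟨φ, S, (φ * (φ - 1)).natDegree, hφ, hS', ?_⟩
  rw [← map_dvd_map' ι, IsAlgClosed.dvd_iff_roots_le_roots (hm hW0) (hm (pow_ne_zero _ hFS)),
    Multiset.le_iff_count]
  intro t
  rw [count_roots, Polynomial.map_pow, roots_pow, Multiset.count_nsmul, count_roots]
  by_cases ht : aeval t (φ * (φ - 1)) = 0
  · have h1 := hmult t ht
    have h2 : ((φ * (φ - 1)).map ι).rootMultiplicity t ≤ (φ * (φ - 1)).natDegree := by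
      rw [← count_roots, ← natDegree_map (p := φ * (φ - 1)) ι]
      exact (Multiset.count_le_card _ _).trans (card_roots' _)
    have h3 : 1 ≤ ((F * S).map ι).rootMultiplicity t := by
      rw [hS', Polynomial.map_mul, rootMultiplicity_mul (mul_ne_zero (hm hFS) (hm hφ'))] at h1
      omega
    nlinarith
  · rw [rootMultiplicity_eq_zero (fun h => ht ((hroot _ t).2 h))]
    exact Nat.zero_le _

theorem exists_belyi_factorization_leadingCoeff_pos (F : ℚ[X]) (hF : F.Separable) :
    ∃ (φ S : ℚ[X]) (b : ℕ), 0 < φ.natDegree ∧ 0 < φ.leadingCoeff ∧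
      φ * (φ - 1) = F * S * derivative φ ∧ φ * (φ - 1) ∣ (F * S) ^ b := by
  obtain ⟨φ, S, b, h1, h2, h3⟩ := exists_belyi_factorization F hF
  have h0 : φ.leadingCoeff ≠ 0 := by
    rw [Ne, leadingCoeff_eq_zero]; rintro rfl; simp at h1
  rcases lt_or_gt_of_ne h0 with h | h
  · have hd : (1 : ℚ[X]).natDegree < φ.natDegree := by simpa using h1
    refine ⟨1 - φ, -S, b * 2, ?_, ?_, ?_, ?_⟩
    · rwa [natDegree_sub_eq_right_of_natDegree_lt hd]
    · rw [leadingCoeff_sub_of_degree_lt' (degree_lt_degree hd)]; linarith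
    · rw [derivative_sub, derivative_one]; linear_combination h2
    · have : (1 - φ) * (1 - φ - 1) = φ * (φ - 1) := by ring
      rw [this, mul_neg, mul_comm b, pow_mul, neg_sq, ← pow_mul, mul_comm 2, pow_mul, sq]
      exact h3.mul_right _
  · exact ⟨φ, S, b, h1, h, h2, h3⟩

end Belyi

section Radical

theorem Rad_pos (m : ℕ) : 0 < Rad m :=
  Finset.prod_pos fun _ hq => (Nat.prime_of_mem_primeFactors hq).pos

theorem Rad_dvd (m : ℕ) : Rad m ∣ m := Nat.prod_primeFactors_dvd m

theorem Rad_le {m : ℕ} (hm : m ≠ 0) : Rad m ≤ m := Nat.le_of_dvd (Nat.pos_of_ne_zero hm) (Rad_dvd m)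

theorem Rad_le_of_subset {a b : ℕ} (h : a.primeFactors ⊆ b.primeFactors) : Rad a ≤ Rad b :=
  Finset.prod_le_prod_of_subset_of_one_le' h
    fun _ hq _ => (Nat.prime_of_mem_primeFactors hq).one_lt.le

theorem Rad_mul_le (a b : ℕ) : Rad (a * b) ≤ Rad a * Rad b := by
  rcases eq_or_ne a 0 with rfl | ha
  · rw [zero_mul]; exact Nat.le_mul_of_pos_right _ (Rad_pos b)
  rcases eq_or_ne b 0 with rfl | hb
  · rw [mul_zero]; exact Nat.le_mul_of_pos_left _ (Rad_pos a)
  unfold Rad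
  rw [Nat.primeFactors_mul ha hb, ← Finset.prod_union_inter]
  exact Nat.le_mul_of_pos_right _ (Finset.prod_pos fun _ hq =>
    (Nat.prime_of_mem_primeFactors (Finset.mem_of_mem_inter_left hq)).pos)

theorem Rad_mul_le_of_sq_dvd {p m : ℕ} (hp : p.Prime) (hm : m ≠ 0) (h : p ^ 2 ∣ m) :
    Rad m * p ≤ m := by
  obtain ⟨r, rfl⟩ := h
  have hr : r ≠ 0 := right_ne_zero_of_mul hm
  have h1 : Rad (p ^ 2 * r) ≤ p * r := by
    refine (Rad_mul_le _ _).trans (Nat.mul_le_mul ?_ (Rad_le hr))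
    unfold Rad
    rw [Nat.primeFactors_prime_pow two_ne_zero hp, Finset.prod_singleton]
  calc _ ≤ p * r * p := Nat.mul_le_mul_right _ h1
    _ = _ := by ring

end Radical

section Growth

theorem exists_abs_eval_le (P : ℤ[X]) {d : ℕ} (hd : P.natDegree ≤ d) :
    ∃ K : ℤ, 0 < K ∧ ∀ x : ℤ, 1 ≤ x → |P.eval x| ≤ K * x ^ d := by
  refine ⟨∑ i ∈ Finset.range (d + 1), |P.coeff i| + 1, ?_, ?_⟩
  · have : 0 ≤ ∑ i ∈ Finset.range (d + 1), |P.coeff i| := Finset.sum_nonneg fun _ _ => abs_nonneg _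
    omega
  · intro x hx
    rw [eval_eq_sum_range' (Nat.lt_succ_of_le hd)]
    refine (Finset.abs_sum_le_sum_abs _ _).trans ?_
    have h1 : ∑ i ∈ Finset.range (d + 1), |P.coeff i * x ^ i| ≤
        (∑ i ∈ Finset.range (d + 1), |P.coeff i|) * x ^ d := by
      rw [Finset.sum_mul]
      refine Finset.sum_le_sum fun i hi => ?_
      rw [abs_mul, abs_of_nonneg (pow_nonneg (by omega) i : 0 ≤ x ^ i)]
      exact mul_le_mul_of_nonneg_left
        (pow_le_pow_right₀ hx (Nat.lt_succ_iff.1 (Finset.mem_range.1 hi))) (abs_nonneg _)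
    have : 0 ≤ x ^ d := pow_nonneg (by omega) d
    calc _ ≤ _ := h1
      _ ≤ _ := by rw [add_mul]; linarith

theorem exists_pow_le_two_mul_eval (P : ℤ[X]) (hd : 0 < P.natDegree) (hl : 0 < P.leadingCoeff) :
    ∃ X₀ : ℤ, ∀ x : ℤ, X₀ ≤ x → x ^ P.natDegree ≤ 2 * P.eval x := by
  obtain ⟨K, hK, h⟩ := exists_abs_eval_le P.eraseLead (eraseLead_natDegree_le P)
  refine ⟨2 * K + 1, fun x hx => ?_⟩
  have h1 := (abs_le.1 (h x (by omega))).1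
  have h2 : P.eval x = P.eraseLead.eval x + P.leadingCoeff * x ^ P.natDegree := by
    conv_lhs => rw [← eraseLead_add_C_mul_X_pow P]
    simp
  obtain ⟨k, hk⟩ : ∃ k, P.natDegree = k + 1 := ⟨P.natDegree - 1, by omega⟩
  rw [hk, Nat.add_sub_cancel] at h1
  rw [h2, hk]
  have h3 : 0 < x ^ k := pow_pos (by omega) k
  have h4 : x ^ (k + 1) ≤ P.leadingCoeff * x ^ (k + 1) :=
    le_mul_of_one_le_left (pow_nonneg (by omega) _) hl
  have h5 : 2 * K * x ^ k ≤ x ^ (k + 1) := by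
    rw [pow_succ']
    exact mul_le_mul_of_nonneg_right (by omega) h3.le
  nlinarith

theorem exists_forall_ge_eval_ne_zero (P : ℤ[X]) (hP : P ≠ 0) :
    ∃ X₀ : ℤ, ∀ x : ℤ, X₀ ≤ x → P.eval x ≠ 0 := by
  obtain ⟨B, hB⟩ := P.roots.toFinset.bddAbove
  refine ⟨B + 1, fun x hx h => ?_⟩
  have := hB (by simpa using ⟨hP, h⟩ : x ∈ (P.roots.toFinset : Set ℤ))
  omega

theorem exists_int_multiple (P : ℚ[X]) :
    ∃ (q : ℤ) (P' : ℤ[X]), 0 < q ∧ P'.map (Int.castRingHom ℚ) = C (q : ℚ) * P := by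
  obtain ⟨b, hbM, hb⟩ := IsLocalization.integerNormalization_spec (nonZeroDivisors ℤ) P
  have hb0 : b ≠ 0 := nonZeroDivisors.ne_zero hbM
  refine ⟨b * b, C b * IsLocalization.integerNormalization (nonZeroDivisors ℤ) P,
    mul_self_pos.2 hb0, ?_⟩
  have h2 : Int.castRingHom ℚ = algebraMap ℤ ℚ := rfl
  have h3 : b • P = C (b : ℚ) * P := by
    rw [zsmul_eq_mul, ← C_eq_intCast]
  rw [Polynomial.map_mul, map_C, h2, hb, h3, ← mul_assoc, ← C_mul, Int.cast_mul]
  rfl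

end Growth

theorem pow_le_mul_sq_of_pow_le_rpow {D : ℕ} (hD : 0 < D) {c : ℝ} (hc : 1 ≤ c) :
    ∀ x B : ℝ, 1 ≤ x → 0 ≤ B → x ^ D ≤ c * B ^ (1 + 1 / (2 * (D : ℝ))) →
      x ^ (2 * D - 1) ≤ c ^ (4 * D) * B ^ 2 := by
  intro x B hx hB h
  have hD' : (D : ℝ) ≠ 0 := by exact_mod_cast hD.ne'
  have h1 : x ^ (4 * D ^ 2) ≤ c ^ (4 * D) * (B ^ 2) ^ (2 * D + 1) := by
    have h2 := pow_le_pow_left₀ (by positivity) h (4 * D)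
    rw [mul_pow, ← Real.rpow_mul_natCast hB] at h2
    have h3 : (1 + 1 / (2 * (D : ℝ))) * ((4 * D : ℕ) : ℝ) = ((2 * (2 * D + 1) : ℕ) : ℝ) := by
      push_cast; field_simp; ring
    rw [h3, Real.rpow_natCast, ← pow_mul, pow_mul B] at h2
    rwa [show 4 * D ^ 2 = D * (4 * D) by ring]
  by_contra! hlt
  have hcp : 1 ≤ c ^ (4 * D) := one_le_pow₀ hc
  have h4 : (c ^ (4 * D) * B ^ 2) ^ (2 * D + 1) < (x ^ (2 * D - 1)) ^ (2 * D + 1) :=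
    pow_lt_pow_left₀ hlt (by positivity) (by omega)
  have h5 : (x ^ (2 * D - 1)) ^ (2 * D + 1) ≤ x ^ (4 * D ^ 2) := by
    rw [← pow_mul]
    refine pow_le_pow_right₀ hx ?_
    obtain ⟨k, rfl⟩ : ∃ k, D = k + 1 := ⟨D - 1, by omega⟩
    have : 2 * (k + 1) - 1 = 2 * k + 1 := by omega
    rw [this]; nlinarith
  have h6 : c ^ (4 * D) * (B ^ 2) ^ (2 * D + 1) ≤ (c ^ (4 * D) * B ^ 2) ^ (2 * D + 1) := by
    rw [mul_pow]
    refine mul_le_mul_of_nonneg_right ?_ (by positivity)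
    exact le_self_pow₀ hcp (by omega)
  linarith

/-- Under the abc-conjecture the values of a separable polynomial have a large radical. -/
theorem exists_pow_le_mul_Rad_eval_sq (habc : AbcConjecture) (F : ℤ[X])
    (hF : (F.map (Int.castRingHom ℚ)).Separable) :
    ∃ (K : ℝ) (X₀ : ℤ), 0 < K ∧ ∀ x : ℤ, X₀ ≤ x →
      (x : ℝ) ^ (2 * F.natDegree) ≤ K * x ^ 3 * (Rad (F.eval x).natAbs : ℝ) ^ 2 := by
  have hinj : Function.Injective (Int.castRingHom ℚ) := Int.cast_injective
  have hF0 : F ≠ 0 := by rintro rfl; exact hF.ne_zero (by simp)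
  obtain ⟨φ, S, b, hφ, hlead, hW, U, hU⟩ := exists_belyi_factorization_leadingCoeff_pos _ hF
  have hφ' : derivative φ ≠ 0 := fun h => hφ.ne' (derivative_eq_zero.1 h)
  have hφ1 : (φ - 1).natDegree = φ.natDegree := natDegree_sub_C (a := (1 : ℚ))
  have hφ0 : φ ≠ 0 := by rintro rfl; simp at hφ
  have hφ10 : φ - 1 ≠ 0 := by intro h; rw [h] at hφ1; simp at hφ1; omega
  have hFS0 : F.map (Int.castRingHom ℚ) * S ≠ 0 := by
    intro h; rw [h, zero_mul] at hW; exact mul_ne_zero hφ0 hφ10 hW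
  have hS0 : S ≠ 0 := right_ne_zero_of_mul hFS0
  have hdegs : F.natDegree + S.natDegree = φ.natDegree + 1 := by
    have h1 := congrArg natDegree hW
    rw [natDegree_mul hφ0 hφ10, hφ1, natDegree_mul hFS0 hφ', natDegree_mul hF.ne_zero hS0,
      natDegree_map_eq_of_injective hinj, natDegree_derivative] at h1
    omega
  obtain ⟨q, Φ, hq, hΦ⟩ := exists_int_multiple φ
  obtain ⟨s, S', hs, hS'⟩ := exists_int_multiple S
  obtain ⟨u, U', hu, hU'⟩ := exists_int_multiple U
  have hqQ : (q : ℚ) ≠ 0 := by exact_mod_cast hq.ne'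
  have hsQ : (s : ℚ) ≠ 0 := by exact_mod_cast hs.ne'
  have hid : C (q ^ 2 * u) * (F * S') ^ b = C (s ^ b) * (Φ * (Φ - C q)) * U' := by
    apply map_injective _ hinj
    simp only [C_mul, C_pow, Polynomial.map_mul, Polynomial.map_pow, Polynomial.map_sub,
      Polynomial.map_C, hΦ, hS', hU', eq_intCast (Int.castRingHom ℚ)]
    have := hU
    rw [mul_pow] at this ⊢
    rw [mul_pow]
    linear_combination (C (q : ℚ) ^ 2 * C (u : ℚ) * C (s : ℚ) ^ b) * this
  have hΦdeg : Φ.natDegree = φ.natDegree := by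
    rw [← natDegree_map_eq_of_injective hinj, hΦ, natDegree_C_mul hqQ]
  have hS'deg : S'.natDegree = S.natDegree := by
    rw [← natDegree_map_eq_of_injective hinj, hS', natDegree_C_mul hsQ]
  have hΦlead : 0 < Φ.leadingCoeff := by
    have h1 : ((Φ.leadingCoeff : ℤ) : ℚ) = q * φ.leadingCoeff := by
      have := leadingCoeff_map_of_injective hinj Φ
      rw [hΦ, leadingCoeff_mul, leadingCoeff_C] at this
      simpa using this.symm
    have h2 : (0 : ℚ) < q := by exact_mod_cast hq
    have h3 : (0 : ℚ) < (Φ.leadingCoeff : ℤ) := by rw [h1]; exact mul_pos h2 hlead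
    exact_mod_cast h3
  have hS'0 : S' ≠ 0 := by
    rintro rfl
    rw [Polynomial.map_zero] at hS'
    rcases mul_eq_zero.1 hS'.symm with h | h
    · exact hsQ (by simpa using h)
    · exact hS0 h
  set D := φ.natDegree with hD
  obtain ⟨X₁, hX₁⟩ := exists_pow_le_two_mul_eval Φ (by omega) hΦlead
  obtain ⟨X₂, hX₂⟩ := exists_forall_ge_eval_ne_zero F hF0
  obtain ⟨X₃, hX₃⟩ := exists_forall_ge_eval_ne_zero S' hS'0
  obtain ⟨κ, hκ, hκS⟩ := exists_abs_eval_le S' le_rfl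
  have hDpos : (0 : ℝ) < D := by exact_mod_cast hφ
  obtain ⟨c, hc, habc⟩ := habc (1 / (2 * (D : ℝ))) (by positivity)
  set c' : ℝ := 2 * q * c + 1 with hc'
  have hq' : (0 : ℝ) < q := by exact_mod_cast hq
  have hu' : (0 : ℝ) < u := by exact_mod_cast hu
  have hκ' : (0 : ℝ) < κ := by exact_mod_cast hκ
  have hc'1 : 1 ≤ c' := by
    have : 0 < 2 * (q : ℝ) * c := by positivity
    linarith
  refine ⟨c' ^ (4 * D) * (q * u * κ) ^ 2, max (max X₁ X₂) (max X₃ (2 * q + 1)), by positivity,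
    fun x hx => ?_⟩
  simp only [max_le_iff] at hx
  obtain ⟨⟨hx1, hx2⟩, hx3, hx4⟩ := hx
  have hx0 : 1 ≤ x := by omega
  have hxR : (1 : ℝ) ≤ x := by exact_mod_cast hx0
  have hxD := hX₁ x hx1
  rw [hΦdeg] at hxD
  have hΦq : q < Φ.eval x := by
    have : x ≤ x ^ D := le_self_pow₀ hx0 (by omega)
    omega
  set R : ℕ := Rad (F.eval x).natAbs with hR
  set a₀ : ℕ := (Φ.eval x - q).toNat with ha₀
  set q₀ : ℕ := q.toNat with hq₀
  have ha₀' : (a₀ : ℤ) = Φ.eval x - q := Int.toNat_of_nonneg (by omega)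
  have hq₀' : (q₀ : ℤ) = q := Int.toNat_of_nonneg (by omega)
  set g := Nat.gcd a₀ q₀ with hg
  have hgpos : 0 < g := Nat.gcd_pos_of_pos_right _ (by omega)
  obtain ⟨a₁, ha₁⟩ : g ∣ a₀ := Nat.gcd_dvd_left _ _
  obtain ⟨q₁, hq₁⟩ : g ∣ q₀ := Nat.gcd_dvd_right _ _
  have hcop : Nat.Coprime a₁ q₁ := by
    have h1 := Nat.coprime_div_gcd_div_gcd (m := a₀) (n := q₀) hgpos
    rwa [← hg, ha₁, hq₁, Nat.mul_div_cancel_left _ hgpos, Nat.mul_div_cancel_left _ hgpos] at h1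
  have ha₁pos : 0 < a₁ := Nat.pos_of_ne_zero (by rintro rfl; omega)
  have hq₁pos : 0 < q₁ := Nat.pos_of_ne_zero (by rintro rfl; omega)
  have hmain := habc a₁ q₁ (a₁ + q₁) ha₁pos hq₁pos (by omega) hcop rfl
  have hsum : (g : ℤ) * ((a₁ + q₁ : ℕ) : ℤ) = Φ.eval x := by
    have h1 : (a₀ : ℤ) = g * a₁ := by exact_mod_cast ha₁
    have h2 : (q₀ : ℤ) = g * q₁ := by exact_mod_cast hq₁
    push_cast
    linarith
  have hgq : (g : ℤ) ≤ q := by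
    have : g ≤ q₀ := Nat.gcd_le_right _ (by omega)
    omega
  have hne : (q * u * F.eval x * S'.eval x).natAbs ≠ 0 :=
    Int.natAbs_ne_zero.2 (mul_ne_zero (mul_ne_zero (mul_ne_zero hq.ne' hu.ne') (hX₂ x hx2))
      (hX₃ x hx3))
  have hradle : Rad (a₁ * q₁ * (a₁ + q₁)) ≤ Rad (q * u * F.eval x * S'.eval x).natAbs := by
    refine Rad_le_of_subset fun p hp => ?_
    obtain ⟨hpp, hpd, -⟩ := Nat.mem_primeFactors.1 hp
    refine Nat.mem_primeFactors.2 ⟨hpp, ?_, hne⟩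
    have hpZ := Nat.prime_iff_prime_int.1 hpp
    rw [← Int.natCast_dvd]
    have key : (p : ℤ) ∣ Φ.eval x * (Φ.eval x - q) → (p : ℤ) ∣ q * u * F.eval x * S'.eval x := by
      intro h
      have h1 := congrArg (eval x) hid
      simp only [eval_mul, eval_C, eval_pow, eval_sub] at h1
      have h2 : (p : ℤ) ∣ q ^ 2 * u * (F.eval x * S'.eval x) ^ b := by
        rw [h1]; exact (h.mul_left _).mul_right _
      rcases hpZ.dvd_or_dvd h2 with h3 | h3
      · rcases hpZ.dvd_or_dvd h3 with h4 | h4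
        · have := hpZ.dvd_of_dvd_pow h4
          exact ((this.mul_right _).mul_right _).mul_right _
        · exact ((h4.mul_left _).mul_right _).mul_right _
      · have := hpZ.dvd_of_dvd_pow h3
        rw [mul_assoc]; exact this.mul_left _
    rcases (Nat.Prime.dvd_mul hpp).1 hpd with h | h
    · rcases (Nat.Prime.dvd_mul hpp).1 h with h | h
      · apply key
        rw [← ha₀', ha₁]
        exact (Int.natCast_dvd_natCast.2 (h.mul_left g)).mul_left _
      · have : (p : ℤ) ∣ q := by
          rw [← hq₀', hq₁]
          exact Int.natCast_dvd_natCast.2 (h.mul_left g)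
        exact ((this.mul_right _).mul_right _).mul_right _
    · apply key
      rw [← hsum]
      exact ((Int.natCast_dvd_natCast.2 h).mul_left _).mul_right _
  set B : ℝ := q * u * R * (κ * x ^ S.natDegree) with hB
  have hradB : (Rad (a₁ * q₁ * (a₁ + q₁)) : ℝ) ≤ B := by
    have h1 : Rad (q * u * F.eval x * S'.eval x).natAbs ≤
        (q * u).natAbs * R * (S'.eval x).natAbs := by
      rw [Int.natAbs_mul, Int.natAbs_mul]
      refine (Rad_mul_le _ _).trans (Nat.mul_le_mul ((Rad_mul_le _ _).trans
        (Nat.mul_le_mul_right _ (Rad_le ?_))) (Rad_le ?_))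
      · exact Int.natAbs_ne_zero.2 (mul_ne_zero hq.ne' hu.ne')
      · exact Int.natAbs_ne_zero.2 (hX₃ x hx3)
    have h2 : ((S'.eval x).natAbs : ℝ) ≤ κ * x ^ S.natDegree := by
      have := hκS x hx0
      rw [hS'deg] at this
      rw [Nat.cast_natAbs]
      exact_mod_cast this
    have h3 : (((q * u).natAbs : ℕ) : ℝ) = q * u := by
      rw [Nat.cast_natAbs, abs_of_pos (mul_pos hq hu)]
      push_cast; rfl
    calc (Rad (a₁ * q₁ * (a₁ + q₁)) : ℝ) ≤ (((q * u).natAbs * R * (S'.eval x).natAbs : ℕ) : ℝ) := by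
          exact_mod_cast hradle.trans h1
      _ ≤ B := by
          push_cast [h3]
          rw [hB]
          exact mul_le_mul_of_nonneg_left h2 (by positivity)
  have hB0 : 0 ≤ B := (Nat.cast_nonneg _).trans hradB
  have hxB : (x : ℝ) ^ D ≤ c' * B ^ (1 + 1 / (2 * (D : ℝ))) := by
    have h1 : (x : ℝ) ^ D ≤ 2 * (q * ((a₁ + q₁ : ℕ) : ℝ)) := by
      have h2 : x ^ D ≤ 2 * (q * ((a₁ + q₁ : ℕ) : ℤ)) := by
        rw [← hsum] at hxD
        have := mul_le_mul_of_nonneg_right hgq (Int.natCast_nonneg (a₁ + q₁))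
        linarith
      exact_mod_cast h2
    have h3 : (Rad (a₁ * q₁ * (a₁ + q₁)) : ℝ) ^ (1 + 1 / (2 * (D : ℝ))) ≤
        B ^ (1 + 1 / (2 * (D : ℝ))) :=
      Real.rpow_le_rpow (Nat.cast_nonneg _) hradB (by positivity)
    have h4 : 0 ≤ B ^ (1 + 1 / (2 * (D : ℝ))) := Real.rpow_nonneg hB0 _
    have h5 := hmain.trans (mul_le_mul_of_nonneg_left h3 hc.le)
    have h6 := mul_le_mul_of_nonneg_left h5 hq'.le
    rw [hc']
    nlinarith
  have hfin := pow_le_mul_sq_of_pow_le_rpow hφ hc'1 x B hxR hB0 hxB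
  have hxS : (0 : ℝ) < x ^ (2 * S.natDegree) := by positivity
  refine le_of_mul_le_mul_right ?_ hxS
  calc (x : ℝ) ^ (2 * F.natDegree) * x ^ (2 * S.natDegree)
      = x ^ 3 * x ^ (2 * D - 1) := by
        rw [← pow_add, ← pow_add]; congr 1; omega
    _ ≤ x ^ 3 * (c' ^ (4 * D) * B ^ 2) := mul_le_mul_of_nonneg_left hfin (by positivity)
    _ = _ := by rw [hB, pow_mul' (x : ℝ) 2 S.natDegree]; ring

section SquareDivisors

theorem exists_bezout_int (f g : ℤ[X])
    (h : IsCoprime (f.map (Int.castRingHom ℚ)) (g.map (Int.castRingHom ℚ))) :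
    ∃ (u v : ℤ[X]) (Δ : ℤ), Δ ≠ 0 ∧ u * f + v * g = C Δ := by
  obtain ⟨a, b, hab⟩ := h
  obtain ⟨q, a', hq, ha⟩ := exists_int_multiple a
  obtain ⟨r, b', hr, hb⟩ := exists_int_multiple b
  refine ⟨C r * a', C q * b', q * r, mul_ne_zero hq.ne' hr.ne', ?_⟩
  apply map_injective (Int.castRingHom ℚ) Int.cast_injective
  simp only [C_mul, Polynomial.map_add, Polynomial.map_mul, Polynomial.map_C, ha, hb,
    eq_intCast (Int.castRingHom ℚ)]
  linear_combination (C (q : ℚ) * C (r : ℚ)) * hab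

variable {f u v : ℤ[X]} {Δ : ℤ} (huv : u * f + v * derivative f = C Δ)

include huv in
theorem not_dvd_eval_derivative {p : ℕ} (hΔ : ¬ (p : ℤ) ∣ Δ) {x : ℤ}
    (hx : (p : ℤ) ∣ f.eval x) : ¬ (p : ℤ) ∣ (derivative f).eval x := by
  intro h
  have h1 := congrArg (eval x) huv
  simp only [eval_add, eval_mul, eval_C] at h1
  exact hΔ (h1 ▸ dvd_add (hx.mul_left _) (h.mul_left _))

include huv in
theorem sq_dvd_sub_of_sq_dvd_eval {p : ℕ} (hp : p.Prime) (hΔ : ¬ (p : ℤ) ∣ Δ) {x y : ℤ}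
    (hx : (p : ℤ) ^ 2 ∣ f.eval x) (hy : (p : ℤ) ^ 2 ∣ f.eval y) (hxy : (p : ℤ) ∣ y - x) :
    (p : ℤ) ^ 2 ∣ y - x := by
  have hpZ := Nat.prime_iff_prime_int.1 hp
  have hd := not_dvd_eval_derivative huv hΔ ((dvd_pow_self _ two_ne_zero).trans hx)
  obtain ⟨h, hh⟩ := hxy
  obtain ⟨k, hk⟩ := f.binomExpansion x (y - x)
  rw [add_sub_cancel, hh] at hk
  have h1 : (p : ℤ) ^ 2 ∣ p * ((derivative f).eval x * h) := by
    have : (p : ℤ) * ((derivative f).eval x * h) = f.eval y - f.eval x - p ^ 2 * (k * h ^ 2) := by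
      rw [hk]; ring
    rw [this]
    exact dvd_sub (dvd_sub hy hx) (dvd_mul_right _ _)
  rw [pow_two] at h1
  have h2 := (hpZ.dvd_or_dvd (Int.dvd_of_mul_dvd_mul_left hpZ.ne_zero h1)).resolve_left hd
  rw [hh, pow_two]
  exact mul_dvd_mul_left _ h2

include huv in
theorem card_filter_sq_dvd_eval_le {p : ℕ} (hp : p.Prime) (hΔ : ¬ (p : ℤ) ∣ Δ) {M : ℕ}
    (hM : ¬ p ∣ M) (x : ℤ) (N : ℕ) :
    {j ∈ Finset.range N | (p : ℤ) ^ 2 ∣ f.eval (x + M * (j : ℕ))}.card ≤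
      (N / p ^ 2 + 1) * f.natDegree := by
  have := Fact.mk hp
  set g := f.map (Int.castRingHom (ZMod p)) with hg
  have hg0 : g ≠ 0 := by
    intro h
    have h1 := congrArg (Polynomial.map (Int.castRingHom (ZMod p))) huv
    rw [Polynomial.map_add, Polynomial.map_mul, Polynomial.map_mul, ← derivative_map, ← hg, h,
      derivative_zero, mul_zero, mul_zero, add_zero, Polynomial.map_C] at h1
    apply hΔ
    rw [← ZMod.intCast_zmod_eq_zero_iff_dvd]
    exact (C_eq_zero.1 h1.symm)
  have hcard : (Finset.range (N / p ^ 2 + 1) ×ˢ g.roots.toFinset).card ≤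
      (N / p ^ 2 + 1) * f.natDegree := by
    rw [Finset.card_product, Finset.card_range]
    exact Nat.mul_le_mul_left _
      ((Multiset.toFinset_card_le _).trans ((card_roots' g).trans natDegree_map_le))
  refine le_trans (Finset.card_le_card_of_injOn
    (fun j : ℕ => (j / p ^ 2, ((x + M * j : ℤ) : ZMod p))) ?_ ?_) hcard
  · intro j hj
    simp only [Finset.coe_filter, Finset.mem_range, Set.mem_ofPred_eq] at hj
    simp only [Finset.coe_product, Set.mem_prod, Finset.mem_coe, Finset.mem_range,
      Multiset.mem_toFinset, mem_roots hg0, IsRoot.def]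
    refine ⟨Nat.lt_succ_of_le (Nat.div_le_div_right hj.1.le), ?_⟩
    rw [hg, ← eq_intCast (Int.castRingHom (ZMod p)), eval_map_apply,
      eq_intCast, ZMod.intCast_zmod_eq_zero_iff_dvd]
    exact (dvd_pow_self _ two_ne_zero).trans hj.2
  · intro j hj l hl hjl
    simp only [Finset.coe_filter, Finset.mem_range, Set.mem_ofPred_eq] at hj hl
    simp only [Prod.mk.injEq] at hjl
    obtain ⟨h1, h2⟩ := hjl
    rw [ZMod.intCast_eq_intCast_iff_dvd_sub] at h2
    have h3 := sq_dvd_sub_of_sq_dvd_eval huv hp hΔ hj.2 hl.2 h2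
    have h4 : (x + M * (l : ℤ)) - (x + M * j) = M * ((l : ℤ) - j) := by ring
    rw [h4] at h3
    have h5 : IsCoprime ((p : ℤ) ^ 2) M :=
      (Nat.isCoprime_iff_coprime.2 ((Nat.Prime.coprime_iff_not_dvd hp).2 hM)).pow_left
    have h6 := h5.dvd_of_dvd_mul_left h3
    have h7 : j ≡ l [MOD p ^ 2] := (Nat.modEq_iff_dvd).2 (by exact_mod_cast h6)
    rw [← Nat.div_add_mod j (p ^ 2), ← Nat.div_add_mod l (p ^ 2), h1, h7]

include huv in
theorem sum_card_filter_sq_dvd_eval_le (hΔ : Δ ≠ 0) {M : ℕ} {z Y : ℕ} (hz : 0 < z)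
    (hzY : z ≤ Y) (hΔz : Δ.natAbs ≤ z) (x : ℤ) (N : ℕ) :
    ((∑ p ∈ Finset.Ioc z Y with p.Prime ∧ ¬ p ∣ M,
      {j ∈ Finset.range N | (p : ℤ) ^ 2 ∣ f.eval (x + M * (j : ℕ))}.card : ℕ) : ℝ) ≤
      f.natDegree * (N / z + Y) := by
  have h1 : ∀ p ∈ {p ∈ Finset.Ioc z Y | p.Prime ∧ ¬ p ∣ M},
      (({j ∈ Finset.range N | (p : ℤ) ^ 2 ∣ f.eval (x + M * (j : ℕ))}.card : ℕ) : ℝ) ≤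
        f.natDegree * (N * ((p : ℝ) ^ 2)⁻¹ + 1) := by
    intro p hp
    rw [Finset.mem_filter, Finset.mem_Ioc] at hp
    obtain ⟨⟨hpz, -⟩, hpp, hpM⟩ := hp
    have hpΔ : ¬ (p : ℤ) ∣ Δ := by
      intro h
      have := Nat.le_of_dvd (Int.natAbs_pos.2 hΔ) (Int.natCast_dvd.1 h)
      omega
    have h2 := card_filter_sq_dvd_eval_le huv hpp hpΔ hpM x N
    have h3 : ((N / p ^ 2 : ℕ) : ℝ) ≤ N * ((p : ℝ) ^ 2)⁻¹ := by
      rw [← div_eq_mul_inv]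
      exact_mod_cast Nat.cast_div_le (α := ℝ) (m := N) (n := p ^ 2)
    calc _ ≤ (((N / p ^ 2 + 1) * f.natDegree : ℕ) : ℝ) := by exact_mod_cast h2
      _ = f.natDegree * ((N / p ^ 2 : ℕ) + 1) := by push_cast; ring
      _ ≤ _ := by gcongr
  rw [Nat.cast_sum]
  refine (Finset.sum_le_sum h1).trans ?_
  refine (Finset.sum_le_sum_of_subset_of_nonneg (Finset.filter_subset _ _)
    fun _ _ _ => by positivity).trans ?_
  rw [← Finset.mul_sum, Finset.sum_add_distrib, ← Finset.mul_sum]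
  have h4 := sum_Ioc_inv_sq_le_sub (α := ℝ) hz.ne' hzY
  have h5 : (0 : ℝ) ≤ (Y : ℝ)⁻¹ := by positivity
  have h6 : (∑ _p ∈ Finset.Ioc z Y, (1 : ℝ)) ≤ Y := by
    rw [Finset.sum_const, Nat.card_Ioc, nsmul_eq_mul, mul_one]
    exact_mod_cast Nat.sub_le _ _
  rw [div_eq_mul_inv]
  gcongr
  linarith

end SquareDivisors

section Shift

theorem exists_isCoprime_comp_X_add_C (f : ℚ[X]) (hf : f ≠ 0) {M : ℕ} (hM : 0 < M) :
    ∃ i : ℕ, 0 < i ∧ IsCoprime f (f.comp (X + C ((i * M : ℕ) : ℚ))) := by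
  classical
  set R : Finset ℂ := (f.aroots ℂ).toFinset with hR
  have hinj : Function.Injective fun i : ℕ => (((i + 1) * M : ℕ) : ℂ) := by
    intro a b hab
    have h : (a + 1) * M = (b + 1) * M := by exact Nat.cast_injective hab
    have := Nat.eq_of_mul_eq_mul_right hM h
    omega
  obtain ⟨c, ⟨i, rfl⟩, hi⟩ := (Set.infinite_range_of_injective hinj).exists_notMem_finset
    (Finset.image₂ (fun a b => a - b) R R)
  refine ⟨i + 1, Nat.succ_pos i, ?_⟩
  rw [isCoprime_iff_aeval_ne_zero_of_isAlgClosed ℚ ℂ]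
  intro a
  by_contra! h
  obtain ⟨h1, h2⟩ := h
  rw [aeval_comp] at h2
  refine hi (Finset.mem_image₂.2 ⟨aeval a (X + C (((i + 1) * M : ℕ) : ℚ)), ?_, a, ?_, ?_⟩)
  · rw [hR, Multiset.mem_toFinset, mem_aroots]; exact ⟨hf, h2⟩
  · rw [hR, Multiset.mem_toFinset, mem_aroots]; exact ⟨hf, h1⟩
  · simp

theorem separable_comp_X_add_C {f : ℚ[X]} (hf : f.Separable) (c : ℚ) :
    (f.comp (X + C c)).Separable := by
  have h := IsCoprime.map hf (compRingHom (X + C c))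
  rw [coe_compRingHom] at h
  rw [Separable, derivative_comp]
  simpa using h

/-- Under the abc-conjecture, two values of `f` at a suitable fixed distance cannot both be
divisible by the square of a large prime. -/
theorem exists_shift_pow_le (habc : AbcConjecture) (f : ℤ[X]) (hdeg : 0 < f.natDegree)
    (hsep : (f.map (Int.castRingHom ℚ)).Separable) {M : ℕ} (hM : 0 < M) :
    ∃ (i : ℕ) (K : ℝ) (X₀ : ℤ), 0 < i ∧ 0 < K ∧ ∀ x : ℤ, X₀ ≤ x → ∀ Y p q : ℕ,
      p.Prime → q.Prime → Y ≤ p → Y ≤ q → (p : ℤ) ^ 2 ∣ f.eval x →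
      (q : ℤ) ^ 2 ∣ f.eval (x + M * i) → (Y : ℝ) ^ 4 ≤ K * x ^ 3 := by
  obtain ⟨i, hi, hcop⟩ := exists_isCoprime_comp_X_add_C _ hsep.ne_zero hM
  set h : ℤ[X] := f.comp (X + C ((i * M : ℕ) : ℤ)) with hh
  have hmap : h.map (Int.castRingHom ℚ) =
      (f.map (Int.castRingHom ℚ)).comp (X + C ((i * M : ℕ) : ℚ)) := by
    rw [hh, Polynomial.map_comp, Polynomial.map_add, Polynomial.map_X, Polynomial.map_C]
    simp
  have hhdeg : h.natDegree = f.natDegree := by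
    rw [hh, natDegree_comp, natDegree_X_add_C, mul_one]
  have hheval : ∀ x : ℤ, h.eval x = f.eval (x + M * i) := by
    intro x
    rw [hh, eval_comp]
    congr 1
    simp
    ring
  have hf0 : f ≠ 0 := by rintro rfl; simp at hdeg
  have hh0 : h ≠ 0 := by intro h0; rw [h0, natDegree_zero] at hhdeg; omega
  have hFsep : ((f * h).map (Int.castRingHom ℚ)).Separable := by
    rw [Polynomial.map_mul, hmap]
    exact hsep.mul (separable_comp_X_add_C hsep _) hcop
  obtain ⟨K, X₁, hK, hX₁⟩ := exists_pow_le_mul_Rad_eval_sq habc (f * h) hFsep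
  obtain ⟨X₂, hX₂⟩ := exists_forall_ge_eval_ne_zero (f * h) (mul_ne_zero hf0 hh0)
  obtain ⟨K₁, hK₁, hf⟩ := exists_abs_eval_le f le_rfl
  obtain ⟨K₂, hK₂, hg⟩ := exists_abs_eval_le h hhdeg.le
  have hK₁' : (0 : ℝ) < K₁ := by exact_mod_cast hK₁
  have hK₂' : (0 : ℝ) < K₂ := by exact_mod_cast hK₂
  refine ⟨i, K * (K₁ * K₂) ^ 2, max (max X₁ X₂) 1, hi, by positivity, ?_⟩
  intro x hx Y p q hp hq hYp hYq hpx hqx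
  simp only [max_le_iff] at hx
  obtain ⟨⟨hx1, hx2⟩, hx3⟩ := hx
  have hxR : (1 : ℝ) ≤ x := by exact_mod_cast hx3
  have hne := hX₂ x hx2
  rw [eval_mul] at hne
  have key : ∀ (g : ℤ[X]) (L : ℤ) (r : ℕ), r.Prime → Y ≤ r → g.eval x ≠ 0 →
      (r : ℤ) ^ 2 ∣ g.eval x → |g.eval x| ≤ L * x ^ f.natDegree →
      (Rad (g.eval x).natAbs : ℝ) * Y ≤ L * x ^ f.natDegree := by
    intro g L r hr hYr h0 hd hL
    have h1 : r ^ 2 ∣ (g.eval x).natAbs := by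
      have := Int.natAbs_dvd_natAbs.2 hd
      rwa [Int.natAbs_pow, Int.natAbs_natCast] at this
    have h2 := Rad_mul_le_of_sq_dvd hr (Int.natAbs_ne_zero.2 h0) h1
    have h3 : Rad (g.eval x).natAbs * Y ≤ (g.eval x).natAbs :=
      (Nat.mul_le_mul_left _ hYr).trans h2
    calc (Rad (g.eval x).natAbs : ℝ) * Y ≤ ((g.eval x).natAbs : ℝ) := by exact_mod_cast h3
      _ = ((|g.eval x| : ℤ) : ℝ) := by rw [Nat.cast_natAbs]
      _ ≤ _ := by exact_mod_cast hL
  have h1 := key f K₁ p hp hYp (left_ne_zero_of_mul hne) hpx (hf x hx3)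
  have h2 := key h K₂ q hq hYq (right_ne_zero_of_mul hne) (by rwa [hheval]) (hg x hx3)
  have h3 := hX₁ x hx1
  have h4 : (Rad ((f * h).eval x).natAbs : ℝ) ≤
      Rad (f.eval x).natAbs * Rad (h.eval x).natAbs := by
    rw [eval_mul, Int.natAbs_mul]
    exact_mod_cast Rad_mul_le _ _
  rw [natDegree_mul hf0 hh0, hhdeg] at h3
  set n := f.natDegree
  have h5 : (Rad ((f * h).eval x).natAbs : ℝ) * (Y : ℝ) ^ 2 ≤ K₁ * K₂ * (x : ℝ) ^ (2 * n) := by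
    calc _ ≤ (Rad (f.eval x).natAbs * Rad (h.eval x).natAbs : ℝ) * (Y : ℝ) ^ 2 := by gcongr
      _ = ((Rad (f.eval x).natAbs : ℝ) * Y) * (Rad (h.eval x).natAbs * Y) := by ring
      _ ≤ (K₁ * x ^ n) * (K₂ * x ^ n) := by gcongr
      _ = _ := by ring
  have h6 : (x : ℝ) ^ (2 * (n + n)) * (Y : ℝ) ^ 4 ≤
      (x : ℝ) ^ (2 * (n + n)) * (K * (K₁ * K₂) ^ 2 * x ^ 3) := by
    calc _ ≤ K * x ^ 3 * (Rad ((f * h).eval x).natAbs : ℝ) ^ 2 * (Y : ℝ) ^ 4 := by gcongr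
      _ = K * x ^ 3 * ((Rad ((f * h).eval x).natAbs : ℝ) * (Y : ℝ) ^ 2) ^ 2 := by ring
      _ ≤ K * x ^ 3 * (K₁ * K₂ * (x : ℝ) ^ (2 * n)) ^ 2 := by gcongr
      _ = _ := by ring
  exact le_of_mul_le_mul_left h6 (by positivity)

end Shift

/-- Under the abc-conjecture, every arithmetic progression whose modulus is divisible by all small
primes contains arbitrarily large `x` such that no prime outside the modulus divides `f(x)` more
than once. -/
theorem exists_eval_squarefree_outside (habc : AbcConjecture) (f : ℤ[X]) (hdeg : 0 < f.natDegree)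
    (hsep : (f.map (Int.castRingHom ℚ)).Separable) :
    ∃ z : ℕ, ∀ M : ℕ, 0 < M → (∀ p : ℕ, p.Prime → p ≤ z → p ∣ M) → ∀ x₁ B : ℤ,
      ∃ x : ℤ, B ≤ x ∧ (M : ℤ) ∣ x - x₁ ∧
        ∀ p : ℕ, p.Prime → ¬ p ∣ M → ¬ (p : ℤ) ^ 2 ∣ f.eval x := by
  classical
  obtain ⟨u, v, Δ, hΔ, huv⟩ := exists_bezout_int f (derivative f) (by
    rw [← derivative_map]; exact hsep)
  set n := f.natDegree with hn
  set z := max Δ.natAbs (8 * n) with hz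
  refine ⟨z, fun M hM hMz x₁ B => ?_⟩
  obtain ⟨i, K, X₀, hi, hK, hshift⟩ := exists_shift_pow_le habc f hdeg hsep hM
  set W : ℤ := max (max X₀ B) 1 with hW
  set x₂ : ℤ := x₁ + M * (|x₁| + |W|) with hx₂
  have hx₂W : W ≤ x₂ := by
    have hM1 : (1 : ℤ) ≤ M := by exact_mod_cast hM
    have h1 : |x₁| + |W| ≤ M * (|x₁| + |W|) := le_mul_of_one_le_left (by positivity) hM1
    have := neg_abs_le x₁
    have := le_abs_self W
    omega
  have hWX : X₀ ≤ W := by omega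
  have hWB : B ≤ W := by omega
  have hW1 : 1 ≤ W := by omega
  obtain ⟨Y, hY⟩ := exists_nat_gt (K * ((x₂ + M) * (8 * n)) ^ 3 + z + i)
  have hx₂0 : (0 : ℝ) < x₂ := by exact_mod_cast (by omega : 0 < x₂)
  have hKpos : 0 < K * ((x₂ + M) * (8 * n) : ℝ) ^ 3 := by positivity
  have hzY : z < Y := by
    have : (z : ℝ) < Y := by
      have : (0 : ℝ) ≤ i := Nat.cast_nonneg i
      linarith
    exact_mod_cast this
  have hiY : i < Y := by
    have : (i : ℝ) < Y := by
      have : (0 : ℝ) ≤ z := Nat.cast_nonneg z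
      linarith
    exact_mod_cast this
  have hYK : K * ((x₂ + M) * (8 * n) : ℝ) ^ 3 < Y := by
    have : (0 : ℝ) ≤ i := Nat.cast_nonneg i
    have : (0 : ℝ) ≤ z := Nat.cast_nonneg z
    linarith
  set N : ℕ := 8 * n * Y with hN
  by_contra! hcon
  have hbad : ∀ j ∈ Finset.range N, ∃ p : ℕ, p.Prime ∧ ¬ p ∣ M ∧
      (p : ℤ) ^ 2 ∣ f.eval (x₂ + M * (j : ℕ)) := by
    intro j _
    have h0 : (0 : ℤ) ≤ M * (j : ℤ) := by positivity
    obtain ⟨p, hp, hpM, hd⟩ := hcon (x₂ + M * j) (by omega)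
      ⟨|x₁| + |W| + j, by rw [hx₂]; ring⟩
    exact ⟨p, hp, hpM, hd⟩
  set L : Finset ℕ := {j ∈ Finset.range N | ∃ p : ℕ, p.Prime ∧ Y ≤ p ∧
    (p : ℤ) ^ 2 ∣ f.eval (x₂ + M * (j : ℕ))} with hL
  have hcover : Finset.range N ⊆ ({p ∈ Finset.Ioc z Y | p.Prime ∧ ¬ p ∣ M}.biUnion fun p =>
      {j ∈ Finset.range N | (p : ℤ) ^ 2 ∣ f.eval (x₂ + M * (j : ℕ))}) ∪ L := by
    intro j hj
    obtain ⟨p, hp, hpM, hd⟩ := hbad j hj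
    have hpz : z < p := by
      by_contra! h
      exact hpM (hMz p hp h)
    rw [Finset.mem_union, Finset.mem_biUnion]
    rcases le_total p Y with h | h
    · exact Or.inl ⟨p, Finset.mem_filter.2 ⟨Finset.mem_Ioc.2 ⟨hpz, h⟩, hp, hpM⟩,
        Finset.mem_filter.2 ⟨hj, hd⟩⟩
    · exact Or.inr (Finset.mem_filter.2 ⟨hj, p, hp, h, hd⟩)
  have hLcard : 2 * L.card ≤ N + i := by
    have hdisj : Disjoint L (L.map (addRightEmbedding i)) := by
      rw [Finset.disjoint_right]
      intro l hl hl'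
      obtain ⟨j, hj, rfl⟩ := Finset.mem_map.1 hl
      obtain ⟨hjN, p, hp, hYp, hpd⟩ := Finset.mem_filter.1 hj
      obtain ⟨-, q, hq, hYq, hqd⟩ := Finset.mem_filter.1 hl'
      have h0 : (0 : ℤ) ≤ M * (j : ℤ) := by positivity
      have h1 := hshift (x₂ + M * j) (by omega) Y p q hp hq hYp hYq hpd (by
        convert hqd using 2
        simp only [addRightEmbedding_apply]
        push_cast
        ring)
      have hjN' : (j : ℝ) ≤ 8 * n * Y := by
        have := (Finset.mem_range.1 hjN).le
        rw [hN] at this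
        exact_mod_cast this
      have hnR : (1 : ℝ) ≤ n := by exact_mod_cast hdeg
      have hY1 : (1 : ℝ) ≤ Y := by exact_mod_cast (by omega : 1 ≤ Y)
      have h2 : ((x₂ + M * j : ℤ) : ℝ) ≤ (x₂ + M) * (8 * n) * Y := by
        push_cast
        have h3 : (M : ℝ) * j ≤ M * (8 * n * Y) := by gcongr
        have h4 : (x₂ : ℝ) * 1 ≤ x₂ * (8 * n * Y) := by
          gcongr
          nlinarith
        linarith
      have h5 : (0 : ℝ) ≤ ((x₂ + M * j : ℤ) : ℝ) := by exact_mod_cast (by omega)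
      have h6 : (Y : ℝ) ^ 3 * Y ≤ Y ^ 3 * (K * ((x₂ + M) * (8 * n)) ^ 3) := by
        calc (Y : ℝ) ^ 3 * Y = Y ^ 4 := by ring
          _ ≤ K * ((x₂ + M * j : ℤ) : ℝ) ^ 3 := h1
          _ ≤ K * ((x₂ + M) * (8 * n) * Y) ^ 3 := by gcongr
          _ = _ := by ring
      have := le_of_mul_le_mul_left h6 (by positivity)
      linarith
    have hsub : L ∪ L.map (addRightEmbedding i) ⊆ Finset.range (N + i) := by
      intro l hl
      rw [Finset.mem_range]
      rcases Finset.mem_union.1 hl with h | h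
      · have := Finset.mem_range.1 (Finset.mem_filter.1 h).1
        omega
      · obtain ⟨j, hj, rfl⟩ := Finset.mem_map.1 h
        have := Finset.mem_range.1 (Finset.mem_filter.1 hj).1
        simp only [addRightEmbedding_apply]
        omega
    have := Finset.card_le_card hsub
    rw [Finset.card_union_of_disjoint hdisj, Finset.card_map, Finset.card_range] at this
    omega
  have hsum := sum_card_filter_sq_dvd_eval_le (M := M) huv hΔ (by omega : 0 < z) hzY.le
    (le_max_left _ _) x₂ N
  have htot := (Finset.card_le_card hcover).trans
    ((Finset.card_union_le _ _).trans (Nat.add_le_add_right Finset.card_biUnion_le _))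
  rw [Finset.card_range] at htot
  set σ := ∑ p ∈ Finset.Ioc z Y with p.Prime ∧ ¬ p ∣ M,
    {j ∈ Finset.range N | (p : ℤ) ^ 2 ∣ f.eval (x₂ + M * (j : ℕ))}.card
  have hzn : (8 * n : ℝ) ≤ z := by exact_mod_cast (le_max_right _ _ : 8 * n ≤ z)
  have hz0 : (0 : ℝ) < z := by exact_mod_cast (by omega : 0 < z)
  have hS : (σ : ℝ) ≤ 2 * n * Y := by
    refine hsum.trans ?_
    have h1 : (N : ℝ) / z ≤ Y := by
      rw [div_le_iff₀ hz0, hN]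
      push_cast
      have := mul_le_mul_of_nonneg_right hzn (Nat.cast_nonneg (α := ℝ) Y)
      linarith
    have : (f.natDegree : ℝ) * (N / z + Y) ≤ n * (Y + Y) := by rw [hn]; gcongr
    linarith
  have hS' : σ ≤ 2 * (n * Y) := by
    have : (σ : ℝ) ≤ 2 * (n * Y) := by linarith
    exact_mod_cast this
  have hN' : N = 8 * (n * Y) := by rw [hN]; ring
  have hnY : Y ≤ n * Y := Nat.le_mul_of_pos_left _ hdeg
  omega

theorem exists_dvd_sub_and_dvd_sub {a b : ℤ} (h : IsCoprime a b) (x y : ℤ) :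
    ∃ w, a ∣ w - x ∧ b ∣ w - y := by
  obtain ⟨r, s, hrs⟩ := h
  exact ⟨x * (s * b) + y * (r * a), ⟨r * (y - x), by linear_combination x * hrs⟩,
    ⟨s * (x - y), by linear_combination y * hrs⟩⟩

theorem IsCoprime.of_dvd_sub {a b c : ℤ} (h : IsCoprime a c) (hab : c ∣ b - a) :
    IsCoprime b c := by
  obtain ⟨k, hk⟩ := hab
  rw [show b = a + c * k by rw [← hk]; ring]
  exact h.add_mul_left_left k

theorem Int.dvd_eval_sub_eval {a x y : ℤ} (f : ℤ[X]) (h : a ∣ x - y) :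
    a ∣ f.eval x - f.eval y :=
  h.trans (sub_dvd_eval_sub x y f)

section LocalRoots

variable {f u v : ℤ[X]} {Δ : ℤ} (huv : u * f + v * derivative f = C Δ)

include huv in
theorem exists_pow_dvd_eval {p : ℕ} (hp : p.Prime) (hΔ : ¬ (p : ℤ) ∣ Δ) {w : ℤ}
    (hw : (p : ℤ) ∣ f.eval w) (e : ℕ) : ∃ x, (p : ℤ) ^ (e + 1) ∣ f.eval x := by
  induction e with
  | zero => exact ⟨w, by simpa using hw⟩
  | succ e ih =>
    obtain ⟨x, g, hg⟩ := ih
    have hd := not_dvd_eval_derivative huv hΔ (x := x) (by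
      rw [hg, pow_succ']; exact (dvd_mul_right _ _).mul_right _)
    obtain ⟨a, b, hab⟩ := ((Nat.prime_iff_prime_int.1 hp).coprime_iff_not_dvd).2 hd
    obtain ⟨k, hk⟩ := f.binomExpansion x (-(g * b) * p ^ (e + 1))
    refine ⟨x + -(g * b) * p ^ (e + 1), g * a + k * (g * b) ^ 2 * p ^ e, ?_⟩
    rw [hk, hg]
    linear_combination (-(p : ℤ) ^ (e + 1) * g) * hab

include huv in
theorem exists_eval_eq_pow_mul {p : ℕ} (hp : p.Prime) (hΔ : ¬ (p : ℤ) ∣ Δ) {w : ℤ}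
    (hw : (p : ℤ) ∣ f.eval w) {e : ℕ} (he : 0 < e) :
    ∃ x g, f.eval x = (p : ℤ) ^ e * g ∧ ¬ (p : ℤ) ∣ g := by
  obtain ⟨e, rfl⟩ : ∃ e', e = e' + 1 := ⟨e - 1, by omega⟩
  obtain ⟨x, g, hg⟩ := exists_pow_dvd_eval huv hp hΔ hw (e + 1)
  have hd := not_dvd_eval_derivative huv hΔ (x := x) (by
    rw [hg, pow_succ']; exact (dvd_mul_right _ _).mul_right _)
  obtain ⟨k, hk⟩ := f.binomExpansion x (p ^ (e + 1))
  refine ⟨x + p ^ (e + 1), (derivative f).eval x + p * (g + k * p ^ e), ?_, ?_⟩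
  · rw [hk, hg]; ring
  · rwa [dvd_add_left (dvd_mul_right _ _)]

include huv in
theorem exists_eval_eq_sq_mul_nat (t : ℕ) (ht : t ≠ 0)
    (h : ∀ p : ℕ, p.Prime → p ∣ t → ¬ (p : ℤ) ∣ Δ ∧ ∃ w : ℤ, (p : ℤ) ∣ f.eval w) :
    ∃ x g : ℤ, f.eval x = (t : ℤ) ^ 2 * g ∧ IsCoprime g t := by
  induction t using Nat.recOnPosPrimePosCoprime with
  | zero => exact absurd rfl ht
  | one => exact ⟨0, f.eval 0, by simp, by simpa using isCoprime_one_right⟩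
  | prime_pow p a hp ha =>
    obtain ⟨hpΔ, w, hw⟩ := h p hp (dvd_pow_self _ ha.ne')
    obtain ⟨x, g, hx, hg⟩ := exists_eval_eq_pow_mul huv hp hpΔ hw (e := a * 2) (by omega)
    refine ⟨x, g, by rw [hx, pow_mul]; push_cast; rfl, ?_⟩
    push_cast
    exact (((Nat.prime_iff_prime_int.1 hp).coprime_iff_not_dvd).2 hg).symm.pow_right
  | coprime a b ha hb hab iha ihb =>
    obtain ⟨x, g, hx, hg⟩ := iha (by omega) fun p hp hpa => h p hp (hpa.mul_right _)
    obtain ⟨y, l, hy, hl⟩ := ihb (by omega) fun p hp hpb => h p hp (hpb.mul_left _)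
    have habZ : IsCoprime (a : ℤ) b := Nat.isCoprime_iff_coprime.2 hab
    obtain ⟨w, hwx, hwy⟩ := exists_dvd_sub_and_dvd_sub (habZ.pow (m := 3) (n := 3)) x y
    obtain ⟨r, hr⟩ := Int.dvd_eval_sub_eval f hwx
    obtain ⟨s, hs⟩ := Int.dvd_eval_sub_eval f hwy
    have h1 : f.eval w = (a : ℤ) ^ 2 * (g + a * r) := by linear_combination hr + hx
    have h2 : f.eval w = (b : ℤ) ^ 2 * (l + b * s) := by linear_combination hs + hy
    obtain ⟨k, hk⟩ := (habZ.pow (m := 2) (n := 2)).mul_dvd ⟨_, h1⟩ ⟨_, h2⟩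
    have ha0 : (a : ℤ) ^ 2 ≠ 0 := pow_ne_zero _ (by omega)
    have hb0 : (b : ℤ) ^ 2 ≠ 0 := pow_ne_zero _ (by omega)
    refine ⟨w, k, by rw [hk]; push_cast; ring, ?_⟩
    push_cast
    refine IsCoprime.mul_right ?_ ?_
    · have h3 : g + a * r = b ^ 2 * k := mul_left_cancel₀ ha0 (by rw [← h1, hk]; ring)
      exact IsCoprime.of_mul_left_right (h3 ▸ hg.add_mul_left_left r)
    · have h3 : l + b * s = a ^ 2 * k := mul_left_cancel₀ hb0 (by rw [← h2, hk]; ring)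
      exact IsCoprime.of_mul_left_right (h3 ▸ hl.add_mul_left_left s)

/-- `t` is a nonzero integer, all of whose prime factors are prime to `E` and divide some value
of `f`. -/
def HasLocalRoots (f : ℤ[X]) (E t : ℤ) : Prop :=
  t ≠ 0 ∧ ∀ p : ℕ, p.Prime → (p : ℤ) ∣ t → ¬ (p : ℤ) ∣ E ∧ ∃ w : ℤ, (p : ℤ) ∣ f.eval w

theorem HasLocalRoots.one (f : ℤ[X]) (E : ℤ) : HasLocalRoots f E 1 :=
  ⟨one_ne_zero, fun _ hp h => absurd (isUnit_of_dvd_one h) (Nat.prime_iff_prime_int.1 hp).not_isUnit⟩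

theorem HasLocalRoots.mul {f : ℤ[X]} {E s t : ℤ} (hs : HasLocalRoots f E s)
    (ht : HasLocalRoots f E t) : HasLocalRoots f E (s * t) :=
  ⟨mul_ne_zero hs.1 ht.1, fun p hp h =>
    ((Nat.prime_iff_prime_int.1 hp).dvd_or_dvd h).elim (hs.2 p hp) (ht.2 p hp)⟩

theorem HasLocalRoots.isCoprime {f : ℤ[X]} {E t : ℤ} (ht : HasLocalRoots f E t) :
    IsCoprime t E := by
  rw [Int.isCoprime_iff_gcd_eq_one]
  by_contra h
  obtain ⟨p, hp, hpd⟩ := Nat.exists_prime_and_dvd h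
  have h1 : (p : ℤ) ∣ (Int.gcd t E : ℤ) := Int.natCast_dvd_natCast.2 hpd
  exact (ht.2 p hp (h1.trans (Int.gcd_dvd_left ..))).1 (h1.trans (Int.gcd_dvd_right ..))

include huv in
theorem HasLocalRoots.exists_eval_eq_sq_mul {E t : ℤ} (hE : Δ ∣ E) (ht : HasLocalRoots f E t) :
    ∃ x g : ℤ, f.eval x = t ^ 2 * g ∧ IsCoprime g t := by
  obtain ⟨x, g, hx, hg⟩ := exists_eval_eq_sq_mul_nat huv t.natAbs (Int.natAbs_ne_zero.2 ht.1)
    fun p hp h => by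
      obtain ⟨h1, h2⟩ := ht.2 p hp (Int.natCast_dvd.2 h)
      exact ⟨fun h3 => h1 (h3.trans hE), h2⟩
  exact ⟨x, g, by rw [hx, Int.natCast_natAbs, sq_abs], hg.of_isCoprime_of_dvd_right
    (Int.dvd_natAbs.2 dvd_rfl)⟩

end LocalRoots

section Residues

variable {f u v : ℤ[X]} {Δ : ℤ} (huv : u * f + v * derivative f = C Δ) (hdeg : 0 < f.natDegree)

theorem natDegree_map_zmod {p : ℕ} (hlead : ¬ (p : ℤ) ∣ f.leadingCoeff) :
    (f.map (Int.castRingHom (ZMod p))).natDegree = f.natDegree := by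
  apply natDegree_map_of_leadingCoeff_ne_zero
  rwa [eq_intCast, Ne, ZMod.intCast_zmod_eq_zero_iff_dvd]

include huv hdeg in
theorem not_forall_eval_pow_eq_zmod {p : ℕ} [Fact p.Prime] (hΔ : ¬ (p : ℤ) ∣ Δ)
    (hlead : ¬ (p : ℤ) ∣ f.leadingCoeff) (hp : 2 * f.natDegree ^ 2 + 2 * f.natDegree < p) {m : ℕ}
    (hm : 0 < m) (hmp : 2 * m < p) (e : ZMod p)
    (h : ∀ x : ℤ, ((f.eval x : ℤ) : ZMod p) = 0 ∨ ((f.eval x : ℤ) : ZMod p) ^ m = e) : False := by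
  have hn := natDegree_map_zmod hlead
  refine not_forall_eval_pow_eq (f := f.map (Int.castRingHom (ZMod p))) (m := m) (e := e)
    (by rwa [hn]) ?_ (by rwa [hn]) hm hmp ?_
  · have h1 := congrArg (Polynomial.map (Int.castRingHom (ZMod p))) huv
    rw [Polynomial.map_add, Polynomial.map_mul, Polynomial.map_mul, ← derivative_map,
      Polynomial.map_C] at h1
    have h2 : (Int.castRingHom (ZMod p)) Δ ≠ 0 := by
      rwa [eq_intCast, Ne, ZMod.intCast_zmod_eq_zero_iff_dvd]
    refine ⟨C ((Int.castRingHom (ZMod p)) Δ)⁻¹ * u.map (Int.castRingHom (ZMod p)),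
      C ((Int.castRingHom (ZMod p)) Δ)⁻¹ * v.map (Int.castRingHom (ZMod p)), ?_⟩
    rw [mul_assoc, mul_assoc, ← mul_add, h1, ← C_mul, inv_mul_cancel₀ h2, C_1]
  · intro a
    obtain ⟨x, rfl⟩ := ZMod.intCast_surjective a
    have := h x
    rwa [← eq_intCast (Int.castRingHom (ZMod p)) x, eval_map_apply, eq_intCast]

theorem HasLocalRoots.of_eval_eq {E c w g : ℤ} (h : f.eval w = c * g) (hg : g ≠ 0)
    (hE : E ∣ g - 1) : HasLocalRoots f E g := by
  refine ⟨hg, fun p hp hpg => ⟨fun hpE => ?_, w, h ▸ hpg.mul_left _⟩⟩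
  have : (p : ℤ) ∣ 1 := by
    have := dvd_sub hpg (hpE.trans hE)
    rwa [sub_sub_cancel] at this
  exact (Nat.prime_iff_prime_int.1 hp).not_isUnit (isUnit_of_dvd_one this)

include huv hdeg in
theorem exists_hasLocalRoots_prime {w₀ E : ℤ} (hΔE : Δ ∣ E) (hE : f.eval w₀ ∣ E) {p : ℕ}
    (hpp : p.Prime) (hpE : ¬ (p : ℤ) ∣ E) (hlead : ¬ (p : ℤ) ∣ f.leadingCoeff)
    (hp : 2 * f.natDegree ^ 2 + 2 * f.natDegree < p) {Q : ℤ} (hQ : ¬ (p : ℤ) ∣ Q) {s : ℤ}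
    (hs : ¬ (p : ℤ) ∣ s) :
    ∃ t, HasLocalRoots f E t ∧ Q ∣ t - 1 ∧ (p : ℤ) ∣ t - s := by
  have := Fact.mk hpp
  have hpZ := Nat.prime_iff_prime_int.1 hpp
  let H : Subgroup (ZMod p)ˣ :=
    { carrier := {a | ∃ t, HasLocalRoots f E t ∧ Q ∣ t - 1 ∧ ((t : ℤ) : ZMod p) = a}
      one_mem' := ⟨1, HasLocalRoots.one f E, by simp, by simp⟩
      mul_mem' := by
        rintro a b ⟨t, ht, htQ, hta⟩ ⟨t', ht', htQ', hta'⟩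
        refine ⟨t * t', ht.mul ht', ?_, by push_cast [hta, hta']; rfl⟩
        rw [show t * t' - 1 = (t - 1) * t' + (t' - 1) by ring]
        exact dvd_add (htQ.mul_right _) htQ'
      inv_mem' := by
        rintro a ⟨t, ht, htQ, hta⟩
        refine ⟨t ^ (p - 2), ?_, ?_, ?_⟩
        · generalize p - 2 = k
          induction k with
          | zero => rw [pow_zero]; exact HasLocalRoots.one f E
          | succ k ih => rw [pow_succ]; exact ih.mul ht
        · exact htQ.trans (sub_one_dvd_pow_sub_one t _)
        · have h1 : a * a ^ (p - 2) = 1 := by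
            rw [← pow_succ', show p - 2 + 1 = p - 1 by have := hpp.two_le; omega,
              ZMod.units_pow_card_sub_one_eq_one]
          rw [← eq_inv_of_mul_eq_one_right h1]
          push_cast [hta]
          rfl }
  have hmem : ∀ a : (ZMod p)ˣ, a ∈ H ↔
    ∃ t, HasLocalRoots f E t ∧ Q ∣ t - 1 ∧ ((t : ℤ) : ZMod p) = a := fun a => Iff.rfl
  have hc : ¬ (p : ℤ) ∣ f.eval w₀ := fun h => hpE (h.trans hE)
  have hHtop : H = ⊤ := by
    by_contra hH
    have hcard : Nat.card (ZMod p)ˣ = p - 1 := by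
      rw [Nat.card_eq_fintype_card, ZMod.card_units]
    have hpos : 0 < Nat.card H := Nat.card_pos
    obtain ⟨k, hk⟩ := Subgroup.card_subgroup_dvd_card H
    rw [hcard] at hk
    have hp2 := hpp.two_le
    have hk1 : k ≠ 1 := by
      rintro rfl
      exact hH (Subgroup.card_eq_iff_eq_top H |>.1 (by rw [hcard, hk, mul_one]))
    have hk0 : k ≠ 0 := by rintro rfl; omega
    have hmp : 2 * Nat.card H < p := by
      have : Nat.card H * 2 ≤ Nat.card H * k := Nat.mul_le_mul_left _ (by omega)
      omega
    refine not_forall_eval_pow_eq_zmod huv hdeg (fun h => hpE (h.trans hΔE)) hlead hp hpos hmp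
      (((f.eval w₀ : ℤ) : ZMod p) ^ Nat.card H) fun x => or_iff_not_imp_left.2 fun hx => ?_
    have hcop : IsCoprime (p : ℤ) (f.eval w₀ * E * Q) := by
      rw [hpZ.coprime_iff_not_dvd]
      intro h
      rcases hpZ.dvd_or_dvd h with h | h
      · exact (hpZ.dvd_or_dvd h).elim hc hpE
      · exact hQ h
    obtain ⟨w, hwx, hww⟩ := exists_dvd_sub_and_dvd_sub hcop x w₀
    obtain ⟨j, hj⟩ := Int.dvd_eval_sub_eval f hww
    have hwg : f.eval w = f.eval w₀ * (1 + E * Q * j) := by linear_combination hj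
    have hxw : ((f.eval x : ℤ) : ZMod p) = ((f.eval w : ℤ) : ZMod p) :=
      (ZMod.intCast_eq_intCast_iff_dvd_sub _ _ _).2 (Int.dvd_eval_sub_eval f hwx)
    set g := 1 + E * Q * j with hg
    rw [hxw, hwg, Int.cast_mul] at hx ⊢
    have hgp : ((g : ℤ) : ZMod p) ≠ 0 := right_ne_zero_of_mul hx
    have hg0 : g ≠ 0 := by rintro h; rw [h] at hgp; simp at hgp
    have hgH : Units.mk0 _ hgp ∈ H := by
      refine (hmem _).2 ⟨g, HasLocalRoots.of_eval_eq hwg hg0 ⟨Q * j, ?_⟩, ⟨E * j, ?_⟩, rfl⟩ <;>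
        rw [hg] <;> ring
    have hpow : (⟨_, hgH⟩ : H) ^ Nat.card H = 1 := pow_card_eq_one'
    have hpow' := congrArg (fun a : H => ((a : (ZMod p)ˣ) : ZMod p)) hpow
    simp only [SubmonoidClass.coe_pow, Units.val_pow_eq_pow_val, Units.val_mk0, OneMemClass.coe_one,
      Units.val_one] at hpow'
    rw [mul_pow, hpow', mul_one]
  have hs0 : ((s : ℤ) : ZMod p) ≠ 0 := by rwa [Ne, ZMod.intCast_zmod_eq_zero_iff_dvd]
  obtain ⟨t, ht, htQ, hts⟩ := (hmem (Units.mk0 _ hs0)).1 (hHtop ▸ Subgroup.mem_top _)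
  exact ⟨t, ht, htQ, (ZMod.intCast_eq_intCast_iff_dvd_sub _ _ _).1 hts.symm⟩

include huv hdeg in
theorem exists_hasLocalRoots_dvd_sub {w₀ E : ℤ} (hΔE : Δ ∣ E) (hE : f.eval w₀ ∣ E) {A : ℕ}
    (hA : Squarefree A) (hAp : ∀ p : ℕ, p.Prime → p ∣ A → ¬ (p : ℤ) ∣ E ∧
      ¬ (p : ℤ) ∣ f.leadingCoeff ∧ 2 * f.natDegree ^ 2 + 2 * f.natDegree < p) {s : ℤ}
    (hs : IsCoprime s A) : ∃ t, HasLocalRoots f E t ∧ (A : ℤ) ∣ t - s := by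
  classical
  have key : ∀ p : ℕ, ∃ t, HasLocalRoots f E t ∧ (p ∈ A.primeFactors →
      ((A / p : ℕ) : ℤ) ∣ t - 1 ∧ (p : ℤ) ∣ t - s) := by
    intro p
    by_cases hp : p ∈ A.primeFactors
    · obtain ⟨hpp, hpA, -⟩ := Nat.mem_primeFactors.1 hp
      obtain ⟨h1, h2, h3⟩ := hAp p hpp hpA
      have hpZ := Nat.prime_iff_prime_int.1 hpp
      obtain ⟨t, ht, htQ, hts⟩ := exists_hasLocalRoots_prime huv hdeg hΔE hE hpp h1 h2 h3
        (Q := ((A / p : ℕ) : ℤ)) (s := s) (by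
          rw [Int.natCast_dvd_natCast]
          intro h
          have h4 : p * p ∣ A := by
            rw [← Nat.mul_div_cancel' hpA]
            exact mul_dvd_mul_left _ h
          exact hpp.not_isUnit (hA p h4))
        (fun h => hpZ.not_isUnit (hs.isUnit_of_dvd' h (Int.natCast_dvd_natCast.2 hpA)))
      exact ⟨t, ht, fun _ => ⟨htQ, hts⟩⟩
    · exact ⟨1, HasLocalRoots.one f E, fun h => absurd h hp⟩
  choose t ht h using key
  refine ⟨∏ p ∈ A.primeFactors, t p, Finset.prod_induction _ _ (fun _ _ => HasLocalRoots.mul)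
    (HasLocalRoots.one f E) fun p _ => ht p, ?_⟩
  rw [Int.natCast_dvd, ← Nat.prod_primeFactors_of_squarefree hA]
  refine Finset.prod_primes_dvd _
    (fun q hq => (Nat.prime_of_mem_primeFactors hq).prime) fun q hq => ?_
  rw [Nat.prod_primeFactors_of_squarefree hA, ← Int.natCast_dvd,
    ← ZMod.intCast_eq_intCast_iff_dvd_sub, Int.cast_prod, Finset.prod_eq_single q]
  · exact (ZMod.intCast_eq_intCast_iff_dvd_sub _ _ _).2 (h q hq).2
  · intro p hp hpq
    rw [← Int.cast_one, eq_comm, ZMod.intCast_eq_intCast_iff_dvd_sub]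
    refine dvd_trans (Int.natCast_dvd_natCast.2 ?_) (h p hp).1
    have hpA := Nat.dvd_of_mem_primeFactors hp
    have hqA := Nat.dvd_of_mem_primeFactors hq
    rw [← Nat.mul_div_cancel' hpA] at hqA
    exact (((Nat.coprime_primes (Nat.prime_of_mem_primeFactors hq)
      (Nat.prime_of_mem_primeFactors hp)).2 hpq.symm)).dvd_of_dvd_mul_left hqA
  · exact fun h' => absurd hq h'

include huv hdeg in
theorem exists_dvd_eval_sub_mul_sq {A : ℕ}
    (hA : Squarefree A) (hAp : ∀ p : ℕ, p.Prime → p ∣ A → ¬ (p : ℤ) ∣ Δ ∧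
      ¬ (p : ℤ) ∣ f.leadingCoeff ∧ 2 * f.natDegree ^ 2 + 2 * f.natDegree < p) {k : ℤ}
    (hk : IsCoprime k A) : ∃ x s : ℤ, IsCoprime s A ∧ (A : ℤ) ∣ f.eval x - k * s ^ 2 := by
  induction A using Nat.recOnPosPrimePosCoprime with
  | zero => exact absurd hA not_squarefree_zero
  | one => exact ⟨0, 1, isCoprime_one_left, by simp⟩
  | prime_pow p a hp ha =>
    obtain rfl : a = 1 := by
      by_contra h1
      have := hA p ⟨p ^ (a - 2), by rw [← pow_two, ← pow_add]; congr 1; omega⟩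
      exact hp.not_isUnit this
    rw [pow_one] at *
    have := Fact.mk hp
    obtain ⟨h1, h2, h3⟩ := hAp p hp (by simp)
    have hpZ := Nat.prime_iff_prime_int.1 hp
    have hk0 : ((k : ℤ) : ZMod p) ≠ 0 := by
      rw [Ne, ZMod.intCast_zmod_eq_zero_iff_dvd]
      exact fun h => hpZ.not_isUnit (hk.isUnit_of_dvd' h dvd_rfl)
    have hp2 : p ≠ 2 := by
      have : 1 ≤ f.natDegree ^ 2 := Nat.one_le_pow _ _ hdeg
      omega
    have hodd := hp.eq_two_or_odd.resolve_left hp2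
    by_contra! hcon
    refine not_forall_eval_pow_eq_zmod huv hdeg h1 h2 h3 (m := p / 2) (by have := hp.two_le; omega)
      (by omega) (-(k : ZMod p) ^ (p / 2)) fun x => or_iff_not_imp_left.2 fun hx => ?_
    have hr : ((f.eval x : ℤ) : ZMod p) / k ≠ 0 := div_ne_zero hx hk0
    have hsq : ¬ IsSquare (((f.eval x : ℤ) : ZMod p) / k) := by
      rintro ⟨b, hb⟩
      obtain ⟨s, rfl⟩ := ZMod.intCast_surjective b
      have hb0 : ((s : ℤ) : ZMod p) ≠ 0 := by rintro h; rw [h, zero_mul] at hb; exact hr hb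
      refine hcon x s ?_ ?_
      · rw [isCoprime_comm, hpZ.coprime_iff_not_dvd, ← ZMod.intCast_zmod_eq_zero_iff_dvd]
        exact hb0
      · rw [← ZMod.intCast_zmod_eq_zero_iff_dvd]
        push_cast
        rw [(div_eq_iff hk0).1 hb]
        ring
    have h4 := (ZMod.pow_div_two_eq_neg_one_or_one p hr).resolve_left
      fun h => hsq ((ZMod.euler_criterion p hr).2 h)
    rw [div_pow, div_eq_iff (pow_ne_zero _ hk0)] at h4
    rw [h4]; ring
  | coprime a b ha hb hab iha ihb =>
    push_cast at hk ⊢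
    have habZ : IsCoprime (a : ℤ) b := Nat.isCoprime_iff_coprime.2 hab
    obtain ⟨x, s, hs, hx⟩ := iha (hA.squarefree_of_dvd (dvd_mul_right _ _))
      (fun p hp h => hAp p hp (h.mul_right _)) hk.of_mul_right_left
    obtain ⟨y, r, hr, hy⟩ := ihb (hA.squarefree_of_dvd (dvd_mul_left _ _))
      (fun p hp h => hAp p hp (h.mul_left _)) hk.of_mul_right_right
    obtain ⟨w, hwx, hwy⟩ := exists_dvd_sub_and_dvd_sub habZ x y
    obtain ⟨l, hls, hlr⟩ := exists_dvd_sub_and_dvd_sub habZ s r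
    refine ⟨w, l, (hs.of_dvd_sub hls).mul_right (hr.of_dvd_sub hlr), habZ.mul_dvd ?_ ?_⟩
    · have : f.eval w - k * l ^ 2 = (f.eval w - f.eval x) + (f.eval x - k * s ^ 2)
          - k * (l + s) * (l - s) := by ring
      rw [this]
      exact dvd_sub (dvd_add (Int.dvd_eval_sub_eval f hwx) hx) (hls.mul_left _)
    · have : f.eval w - k * l ^ 2 = (f.eval w - f.eval y) + (f.eval y - k * r ^ 2)
          - k * (l + r) * (l - r) := by ring
      rw [this]
      exact dvd_sub (dvd_add (Int.dvd_eval_sub_eval f hwy) hy) (hlr.mul_left _)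

end Residues

section SquarefreeValues

theorem Int.exists_squarefree_mul_sq {c : ℤ} (hc : c ≠ 0) :
    ∃ a b : ℤ, Squarefree a ∧ b ≠ 0 ∧ c = a * b ^ 2 := by
  obtain ⟨a, b, hab, ha⟩ := Nat.sq_mul_squarefree c.natAbs
  have hb : (b : ℤ) ≠ 0 := by
    rintro h
    have : b = 0 := by exact_mod_cast h
    rw [this] at hab
    simp at hab
    exact hc (Int.natAbs_eq_zero.1 hab.symm)
  refine ⟨c.sign * a, b, ?_, hb, ?_⟩
  · rw [← Int.squarefree_natAbs, Int.natAbs_mul, Int.natAbs_sign_of_ne_zero hc, one_mul,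
      Int.natAbs_natCast]
    exact ha
  · have : ((b : ℤ) ^ 2 * a) = c.natAbs := by exact_mod_cast hab
    rw [mul_assoc, mul_comm (a : ℤ), this, Int.sign_mul_natAbs]

theorem exists_coprime_forall_prime_dvd (N : ℤ) (z : ℕ) :
    ∃ q : ℤ, q ≠ 0 ∧ IsCoprime q N ∧ ∀ p : ℕ, p.Prime → p ≤ z → (p : ℤ) ∣ N * q := by
  classical
  refine ⟨∏ p ∈ Finset.filter (fun p : ℕ => p.Prime ∧ ¬ (p : ℤ) ∣ N) (Finset.range (z + 1)), (p : ℤ), ?_, ?_, ?_⟩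
  · refine Finset.prod_ne_zero_iff.2 fun p hp => ?_
    exact_mod_cast (Finset.mem_filter.1 hp).2.1.ne_zero
  · refine IsCoprime.prod_left fun p hp => ?_
    obtain ⟨-, hp, hpN⟩ := Finset.mem_filter.1 hp
    exact (Nat.prime_iff_prime_int.1 hp).coprime_iff_not_dvd.2 hpN
  · intro p hp hpz
    by_cases hpN : (p : ℤ) ∣ N
    · exact hpN.mul_right _
    · exact (Finset.dvd_prod_of_mem (fun p : ℕ => (p : ℤ)) (Finset.mem_filter.2
        ⟨Finset.mem_range.2 (by omega), hp, hpN⟩)).mul_left _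

variable {f u v : ℤ[X]} {Δ : ℤ} (huv : u * f + v * derivative f = C Δ) (hdeg : 0 < f.natDegree)

include huv hdeg in
/-- For a fixed nonzero `y`, unboundedly many `f(x)` have the form `d * y ^ 2` with `d` squarefree
in a given residue class. -/
theorem exists_forall_exists_eval_eq_mul_sq (habc : AbcConjecture)
    (hsep : (f.map (Int.castRingHom ℚ)).Separable) {w₀ E : ℤ} (hΔE : Δ ∣ E) (hE : f.eval w₀ ∣ E)
    (hE0 : E ≠ 0) {A : ℕ} (hA : Squarefree A)
    (hAp : ∀ p : ℕ, p.Prime → p ∣ A → ¬ (p : ℤ) ∣ E ∧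
      ¬ (p : ℤ) ∣ f.leadingCoeff ∧ 2 * f.natDegree ^ 2 + 2 * f.natDegree < p) {k : ℤ}
    (hk : IsCoprime k A) :
    ∃ y : ℤ, y ≠ 0 ∧ ∀ B : ℤ, ∃ x d : ℤ, B ≤ x ∧ Squarefree d ∧ (A : ℤ) ∣ d - k ∧
      f.eval x = d * y ^ 2 := by
  set c := f.eval w₀ with hc
  have hc0 : c ≠ 0 := fun h => hE0 (zero_dvd_iff.1 (h ▸ hE))
  have hA0 : (A : ℤ) ≠ 0 := by exact_mod_cast hA.ne_zero
  have hEA : IsCoprime E A := by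
    rw [Int.isCoprime_iff_gcd_eq_one]
    by_contra h
    obtain ⟨p, hp, hpd⟩ := Nat.exists_prime_and_dvd h
    have h1 : (p : ℤ) ∣ (Int.gcd E A : ℤ) := Int.natCast_dvd_natCast.2 hpd
    exact (hAp p hp (Int.natCast_dvd_natCast.1 (h1.trans (Int.gcd_dvd_right ..)))).1
      (h1.trans (Int.gcd_dvd_left ..))
  have hcA : IsCoprime c A := hEA.of_isCoprime_of_dvd_left hE
  obtain ⟨a, b, ha, hb0, hab⟩ := Int.exists_squarefree_mul_sq hc0
  have hbA : IsCoprime b A := hcA.of_isCoprime_of_dvd_left ⟨a * b, by rw [hab]; ring⟩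
  obtain ⟨xA, s, hs, hxA⟩ := exists_dvd_eval_sub_mul_sq huv hdeg hA
    (fun p hp h => ⟨fun h' => (hAp p hp h).1 (h'.trans hΔE), (hAp p hp h).2⟩) hk
  obtain ⟨α, β, hαβ⟩ := id hbA
  obtain ⟨t, ht, hts⟩ := exists_hasLocalRoots_dvd_sub huv hdeg hΔE hE hA hAp (s := α * s)
    (IsCoprime.mul_left ⟨b, β, by linear_combination hαβ⟩ hs)
  have htA : IsCoprime t A :=
    (IsCoprime.mul_left (⟨b, β, by linear_combination hαβ⟩ : IsCoprime α (A : ℤ)) hs).of_dvd_sub hts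
  have htc : IsCoprime t c := ht.isCoprime.of_isCoprime_of_dvd_right hE
  have hbts : (A : ℤ) ∣ b * t - s := by
    have : b * t - s = b * (t - α * s) - A * (β * s) := by linear_combination s * hαβ
    rw [this]
    exact dvd_sub (hts.mul_left _) (dvd_mul_right _ _)
  obtain ⟨xt, gt, hxt, hgt⟩ := ht.exists_eval_eq_sq_mul huv hΔE
  obtain ⟨z, hz⟩ := exists_eval_squarefree_outside habc f hdeg hsep
  obtain ⟨q, hq0, hq, hqz⟩ := exists_coprime_forall_prime_dvd (A * t * c) z
  have hqA : IsCoprime q A := hq.of_mul_right_left.of_mul_right_left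
  have hqt : IsCoprime q t := hq.of_mul_right_left.of_mul_right_right
  obtain ⟨x₀, hx₀t, hx₀c⟩ := exists_dvd_sub_and_dvd_sub
    ((hqt.symm.mul_right (htc.pow_right (n := 2))).pow_left (m := 3)) xt w₀
  obtain ⟨x₁, hx₁A, hx₁⟩ := exists_dvd_sub_and_dvd_sub (a := (A : ℤ)) (b := t ^ 3 * (q * c ^ 2))
    (htA.symm.pow_right.mul_right (hqA.symm.mul_right hcA.symm.pow_right)) xA x₀
  refine ⟨b * t, mul_ne_zero hb0 ht.1, fun B => ?_⟩
  set M : ℤ := A * (t ^ 3 * (q * c ^ 2)) with hM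
  have hM0 : M ≠ 0 := mul_ne_zero hA0
    (mul_ne_zero (pow_ne_zero _ ht.1) (mul_ne_zero hq0 (pow_ne_zero _ hc0)))
  obtain ⟨x, hxB, hxM, hx⟩ := hz M.natAbs (Int.natAbs_pos.2 hM0) (fun p hp hpz => by
    rw [← Int.natCast_dvd]
    exact (hqz p hp hpz).trans ⟨t ^ 2 * c, by rw [hM]; ring⟩) x₁ B
  rw [Int.natAbs_dvd] at hxM
  have hxA' : (A : ℤ) ∣ x - xA := by
    have := dvd_add ((dvd_mul_right _ _).trans hxM) hx₁A
    rwa [sub_add_sub_cancel] at this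
  have hx' : t ^ 3 * (q * c ^ 2) ∣ x - x₀ := by
    have := dvd_add ((dvd_mul_left _ _).trans hxM) hx₁
    rwa [sub_add_sub_cancel] at this
  have hxt' : t ^ 3 ∣ x - xt := by
    have := dvd_add ((dvd_mul_right _ _).trans hx') hx₀t
    rwa [sub_add_sub_cancel] at this
  have hxc' : q * c ^ 2 ∣ x - w₀ := by
    have := dvd_add ((dvd_mul_left _ _).trans hx') hx₀c
    rwa [sub_add_sub_cancel] at this
  obtain ⟨i, hi⟩ := Int.dvd_eval_sub_eval f hxc'
  obtain ⟨j, hj⟩ := Int.dvd_eval_sub_eval f hxt'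
  have h1 : f.eval x = c * (1 + q * c * i) := by rw [← hc] at hi; linear_combination hi
  have h2 : f.eval x = t ^ 2 * (gt + t * j) := by linear_combination hj + hxt
  obtain ⟨g, hg⟩ : t ^ 2 ∣ 1 + q * c * i :=
    (htc.pow_left (m := 2)).dvd_of_dvd_mul_left (h1 ▸ ⟨_, h2⟩)
  have hfg : f.eval x = c * t ^ 2 * g := by rw [h1, hg]; ring
  have hgc : IsCoprime g c := by
    refine ⟨t ^ 2, -(q * i), ?_⟩
    linear_combination -hg
  have hgq : IsCoprime g q := by
    refine ⟨t ^ 2, -(c * i), ?_⟩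
    linear_combination -hg
  have hgt' : IsCoprime g t := by
    have h3 : gt + t * j = c * g :=
      mul_left_cancel₀ (pow_ne_zero 2 ht.1) (by rw [← h2, hfg]; ring)
    exact IsCoprime.of_mul_left_right (h3 ▸ hgt.add_mul_left_left j)
  have hfA : (A : ℤ) ∣ f.eval x - k * s ^ 2 := by
    have := dvd_add (Int.dvd_eval_sub_eval f hxA') hxA
    rwa [sub_add_sub_cancel] at this
  have hgA : IsCoprime g A := by
    have h3 : IsCoprime (f.eval x) A := (hk.mul_left hs.pow_left).of_dvd_sub hfA
    exact h3.of_isCoprime_of_dvd_left ⟨c * t ^ 2, by rw [hfg]; ring⟩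
  have hgM : IsCoprime g M :=
    hgA.mul_right (hgt'.pow_right.mul_right (hgq.mul_right hgc.pow_right))
  have hgsq : Squarefree g := by
    rw [← Int.squarefree_natAbs, Nat.squarefree_iff_prime_squarefree]
    intro p hp hpg
    have hpg' : (p : ℤ) ^ 2 ∣ g := by
      rw [pow_two]
      exact_mod_cast Int.natCast_dvd.2 hpg
    refine hx p hp (fun h => ?_) (hfg ▸ hpg'.mul_left _)
    exact (Nat.prime_iff_prime_int.1 hp).not_isUnit (hgM.isUnit_of_dvd'
      ((dvd_pow_self _ two_ne_zero).trans hpg') (Int.natCast_dvd.2 h))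
  have hfd : f.eval x = a * g * (b * t) ^ 2 := by rw [hfg, hab]; ring
  refine ⟨x, a * g, hxB, ?_, ?_, hfd⟩
  · rw [squarefree_mul_iff]
    refine ⟨(hgc.symm.of_isCoprime_of_dvd_left ⟨b ^ 2, hab⟩).isRelPrime, ha, hgsq⟩
  · have h3 : (A : ℤ) ∣ s ^ 2 * (a * g - k) := by
      have : s ^ 2 * (a * g - k) = (f.eval x - k * s ^ 2) -
          a * g * (b * t + s) * (b * t - s) := by rw [hfd]; ring
      rw [this]
      exact dvd_sub hfA (hbts.mul_left _)
    exact hs.symm.pow_right.dvd_of_dvd_mul_left h3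

end SquarefreeValues

theorem stmt_4 (f : Polynomial ℤ) (hdeg : 0 < f.natDegree)
    (hsep : (f.map (Int.castRingHom ℚ)).Separable)
    (habc : AbcConjecture) :
    ∃ S₀ : Finset ℕ, (∀ q ∈ S₀, q.Prime) ∧
      ∀ A : ℤ, 1 < A → Squarefree A → (∀ q ∈ S₀, ¬ ((q : ℤ) ∣ A)) →
        ∀ k : ℤ, IsCoprime k A →
          {d : ℤ | Squarefree d ∧ d ≡ k [ZMOD A] ∧
            ∃ x y : ℚ, y ≠ 0 ∧ (d : ℚ) * y ^ 2 = Polynomial.aeval x f}.Infinite := by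
  have hf0 : f ≠ 0 := by rintro rfl; simp at hdeg
  obtain ⟨u, v, Δ, hΔ, huv⟩ := exists_bezout_int f (derivative f) (by
    rw [← derivative_map]; exact hsep)
  obtain ⟨w₀, hw₀⟩ := exists_forall_ge_eval_ne_zero f hf0
  specialize hw₀ w₀ le_rfl
  set E := Δ * f.eval w₀ with hE
  have hE0 : E ≠ 0 := mul_ne_zero hΔ hw₀
  refine ⟨(E * f.leadingCoeff).natAbs.primeFactors ∪
    {p ∈ Finset.range (2 * f.natDegree ^ 2 + 2 * f.natDegree + 1) | p.Prime}, ?_, ?_⟩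
  · intro q hq
    rcases Finset.mem_union.1 hq with h | h
    · exact Nat.prime_of_mem_primeFactors h
    · exact (Finset.mem_filter.1 h).2
  intro A hA1 hA hAS k hk
  lift A to ℕ using by omega
  have hAp : ∀ p : ℕ, p.Prime → p ∣ A → ¬ (p : ℤ) ∣ E * f.leadingCoeff ∧
      2 * f.natDegree ^ 2 + 2 * f.natDegree < p := by
    intro p hp hpA
    constructor
    · intro h
      refine hAS p (Finset.mem_union_left _ (Nat.mem_primeFactors.2 ⟨hp, Int.natCast_dvd.1 h, ?_⟩))
        (Int.natCast_dvd_natCast.2 hpA)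
      exact Int.natAbs_ne_zero.2 (mul_ne_zero hE0 (leadingCoeff_ne_zero.2 hf0))
    · by_contra! h
      exact hAS p (Finset.mem_union_right _ (Finset.mem_filter.2
        ⟨Finset.mem_range.2 (by omega), hp⟩)) (Int.natCast_dvd_natCast.2 hpA)
  obtain ⟨y, hy0, hy⟩ := exists_forall_exists_eval_eq_mul_sq huv hdeg habc hsep
    (dvd_mul_right Δ _) (dvd_mul_left _ _) hE0 (Int.squarefree_natCast.1 hA)
    (fun p hp h => ⟨fun h' => (hAp p hp h).1 (h'.mul_right _),
      fun h' => (hAp p hp h).1 (h'.mul_left _), (hAp p hp h).2⟩) hk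
  intro hfin
  have hX : {x : ℤ | ∃ d ∈ {d : ℤ | Squarefree d ∧ d ≡ k [ZMOD A] ∧
      ∃ x y : ℚ, y ≠ 0 ∧ (d : ℚ) * y ^ 2 = Polynomial.aeval x f},
      f.eval x = d * y ^ 2}.Infinite := by
    refine Set.infinite_of_not_bddAbove ?_
    rintro ⟨B, hB⟩
    obtain ⟨x, d, hxB, hd, hdk, hx⟩ := hy (B + 1)
    have := hB (show x ∈ _ from ⟨d, ⟨hd, (Int.modEq_iff_dvd.2 hdk).symm, x, y, by exact_mod_cast hy0,
      by
        rw [← eq_intCast (algebraMap ℤ ℚ) x, aeval_algebraMap_apply, coe_aeval_eq_eval, hx]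
        simp⟩, hx⟩)
    omega
  refine hX ((hfin.biUnion fun d _ =>
    (f - C (d * y ^ 2)).roots.toFinset.finite_toSet).subset ?_)
  rintro x ⟨d, hd, hx⟩
  refine Set.mem_biUnion hd ?_
  have hne : f - C (d * y ^ 2) ≠ 0 := by
    intro h
    have := congrArg natDegree h
    rw [natDegree_sub_C, natDegree_zero] at this
    omega
  simp only [Finset.mem_coe, Multiset.mem_toFinset, mem_roots hne, IsRoot.def, eval_sub, eval_C]
  rw [hx, sub_self]
end

section
/- Let p₁, …, p_r be distinct prime numbers, each congruent to 1 modulo 3. Then there exists a Galois number field K/ℚ with Galois group isomorphic to the cyclic group ℤ/3ℤ such that the set of prime numbers dividing the discriminant of K is exactly {p₁, …, p_r} (i.e., K/ℚ is ramified exactly at p₁, …, p_r). -/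
open NumberField

/-- Inertia at a prime above `ℓ` acts trivially on a Galois subfield unramified at `ℓ`. -/
theorem restrictNormal_eq_one_of_mem_inertia {F L : Type*} [Field F] [NumberField F] [Field L]
    [NumberField L] [Algebra F L] [IsGalois ℚ F] [IsGalois ℚ L] {ℓ : ℕ} (hℓ : ℓ.Prime)
    (hF : ¬ (ℓ : ℤ) ∣ discr F) (P : Ideal (𝓞 L)) [P.IsPrime]
    [P.LiesOver (Ideal.span {(ℓ : ℤ)})] {σ : Gal(L/ℚ)} (hσ : σ ∈ P.inertia Gal(L/ℚ)) :
    σ.restrictNormal F = 1 := by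
  have hp : Prime (ℓ : ℤ) := Nat.prime_iff_prime_int.mp hℓ
  have : (Ideal.span {(ℓ : ℤ)}).IsPrime := (Ideal.span_singleton_prime hp.ne_zero).mpr hp
  let Q : Ideal (𝓞 F) := P.under (𝓞 F)
  have : Q.LiesOver (Ideal.span {(ℓ : ℤ)}) := inferInstance
  have hQ : Nat.card (Q.inertia Gal(F/ℚ)) = 1 := by
    rw [Ideal.card_inertia_eq_ramificationIdxIn (Ideal.span {(ℓ : ℤ)}) Q,
      Ideal.ramificationIdxIn_eq_ramificationIdx (Ideal.span {(ℓ : ℤ)}) Q Gal(F/ℚ)]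
    exact ((not_dvd_discr_iff_isUnramifiedIn F (𝓞 F) hp).mp hF).ramificationIdx_eq_one ‹_›
  rw [Subgroup.card_eq_one] at hQ
  rw [← Subgroup.mem_bot, ← hQ]
  intro x
  have := hσ (algebraMap (𝓞 F) (𝓞 L) x)
  have hx : algebraMap (𝓞 F) (𝓞 L) (σ.restrictNormal F • x) = σ • algebraMap (𝓞 F) (𝓞 L) x :=
    FaithfulSMul.algebraMap_injective (𝓞 L) L (AlgEquiv.restrictNormal_commutes σ F (x : F))
  change algebraMap (𝓞 F) (𝓞 L) (σ.restrictNormal F • x - x) ∈ P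
  rw [map_sub, hx]
  exact this

theorem discr_cyclotomic_dvd_pow (n : ℕ) [NeZero n] (L : Type*) [Field L] [NumberField L]
    [IsCyclotomicExtension {n} ℚ L] : discr L ∣ (n : ℤ) ^ n.totient := by
  rw [← Int.natAbs_dvd, IsCyclotomicExtension.Rat.natAbs_discr n L]
  exact_mod_cast Nat.div_dvd_of_dvd (Nat.prod_primeFactors_pow_totient_ediv_dvd (NeZero.pos _))

/-- If `n = ℓ * m` with `ℓ ∤ m`, the inertia group at a prime of `ℚ(ζₙ)` above `ℓ` contains the
automorphisms attached to units that are trivial modulo `m`. -/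
theorem galEquivZMod_symm_mem_inertia {n m ℓ : ℕ} [NeZero n] [NeZero m] (hℓ : ℓ.Prime)
    (hn : n = ℓ * m) (hm : ¬ ℓ ∣ m)
    (L : Type*) [Field L] [NumberField L] [IsCyclotomicExtension {n} ℚ L] [IsGalois ℚ L]
    (P : Ideal (𝓞 L)) [P.IsPrime] [P.LiesOver (Ideal.span {(ℓ : ℤ)})]
    {u : (ZMod n)ˣ} (hu : ZMod.unitsMap (Dvd.intro_left ℓ hn.symm) u = 1) :
    (IsCyclotomicExtension.Rat.galEquivZMod n L).symm u ∈ P.inertia Gal(L/ℚ) := by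
  have hp : Prime (ℓ : ℤ) := Nat.prime_iff_prime_int.mp hℓ
  have : Fact ℓ.Prime := ⟨hℓ⟩
  have : (Ideal.span {(ℓ : ℤ)}).IsPrime := (Ideal.span_singleton_prime hp.ne_zero).mpr hp
  have hmn : m ∣ n := Dvd.intro_left ℓ hn.symm
  let F : IntermediateField ℚ L :=
    IntermediateField.adjoin ℚ {(IsCyclotomicExtension.zeta n ℚ L) ^ ℓ}
  have : IsCyclotomicExtension {m} ℚ F :=
    ((IsCyclotomicExtension.zeta_spec n ℚ L).pow
      (NeZero.pos _) hn).intermediateField_adjoin_isCyclotomicExtension ℚ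
  have : IsGalois ℚ F := IsCyclotomicExtension.isGalois {m} ℚ F
  have hF : ¬ (ℓ : ℤ) ∣ discr F := fun h ↦ hm <| by
    exact_mod_cast hp.dvd_of_dvd_pow (h.trans (discr_cyclotomic_dvd_pow m F))
  let e := IsCyclotomicExtension.Rat.galEquivZMod n L
  have hle : (P.inertia Gal(L/ℚ)).map e.toMonoidHom ≤ (ZMod.unitsMap hmn).ker := by
    rintro _ ⟨σ, hσ, rfl⟩
    have := IsCyclotomicExtension.Rat.galEquivZMod_restrictNormal_apply n L F hmn σ
    rw [restrictNormal_eq_one_of_mem_inertia hℓ hF P hσ, map_one] at this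
    exact this.symm
  have hcard : Nat.card (ZMod.unitsMap hmn).ker = ℓ - 1 := by
    have h := (ZMod.unitsMap hmn).ker.card_mul_index
    rw [Subgroup.index_ker, MonoidHom.range_eq_top.mpr (ZMod.unitsMap_surjective hmn),
      Subgroup.card_top, Nat.card_eq_fintype_card, Nat.card_eq_fintype_card,
      Nat.card_eq_fintype_card, ZMod.card_units_eq_totient, ZMod.card_units_eq_totient] at h
    simp only [hn] at h
    rw [Nat.totient_mul ((Nat.Prime.coprime_iff_not_dvd hℓ).mpr hm), Nat.totient_prime hℓ] at h
    rw [Nat.card_eq_fintype_card]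
    exact Nat.eq_of_mul_eq_mul_right (Nat.totient_pos.mpr (NeZero.pos m)) h
  have heq := Subgroup.eq_of_le_of_card_ge hle (by
    rw [hcard, Nat.card_congr ((P.inertia Gal(L/ℚ)).equivMapOfInjective
        e.toMonoidHom e.injective).symm.toEquiv,
      Ideal.card_inertia_eq_ramificationIdxIn (Ideal.span {(ℓ : ℤ)}) P,
      IsCyclotomicExtension.Rat.ramificationIdxIn_eq (k := 0) n L (by simpa using hn) hm]
    simp)
  obtain ⟨σ, hσ, h⟩ := heq.ge hu
  rw [← h]
  exact (e.symm_apply_apply σ).symm ▸ hσ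

theorem exists_surjective_units_zmod_three {q : ℕ} (hq : q.Prime) (h : q % 3 = 1) :
    ∃ f : (ZMod q)ˣ →* Multiplicative (ZMod 3), Function.Surjective f := by
  have : Fact q.Prime := ⟨hq⟩
  have h3 : 3 ∣ Nat.card (ZMod q)ˣ := by
    rw [Nat.card_eq_fintype_card, ZMod.card_units]; omega
  refine ⟨((ZMod.castHom h3 (ZMod 3)).toAddMonoidHom.toMultiplicative).comp
    (zmodCyclicMulEquiv (G := (ZMod q)ˣ) inferInstance).symm.toMonoidHom, ?_⟩
  exact Function.Surjective.comp (g := ZMod.castHom h3 (ZMod 3)) (ZMod.castHom_surjective h3)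
    (zmodCyclicMulEquiv (G := (ZMod q)ˣ) inferInstance).symm.surjective

/-- The value of a product of characters of coprime moduli can be prescribed by a single factor, at a
unit that is trivial modulo the other moduli. -/
theorem exists_unit_prod_comp_unitsMap_eq {ι : Type*} [Fintype ι] [DecidableEq ι]
    (p : ι → ℕ) (hinj : Function.Injective p)
    (hprime : ∀ i, (p i).Prime) (f : ∀ i, (ZMod (p i))ˣ →* Multiplicative (ZMod 3)) (i : ι)
    {m : ℕ} (hm : ∏ j, p j = p i * m) (x : (ZMod (p i))ˣ) :
    ∃ u : (ZMod (∏ j, p j))ˣ, ZMod.unitsMap (Dvd.intro_left (p i) hm.symm) u = 1 ∧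
      (∏ j, (f j).comp (ZMod.unitsMap (Finset.dvd_prod_of_mem p (Finset.mem_univ j)))) u = f i x := by
  have : ∀ i, Fact (p i).Prime := fun i ↦ ⟨hprime i⟩
  have hpim : m = ∏ j ∈ Finset.univ.erase i, p j := by
    rw [← Finset.mul_prod_erase _ _ (Finset.mem_univ i)] at hm
    exact (Nat.eq_of_mul_eq_mul_left (hprime i).pos hm).symm
  have hco : (p i).Coprime m := by
    rw [hpim]
    refine Nat.Coprime.prod_right fun j hj ↦ (Nat.coprime_primes (hprime i) (hprime j)).mpr ?_
    exact fun h ↦ Finset.ne_of_mem_erase hj (hinj h).symm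
  obtain ⟨a, ha1, ha2⟩ := Nat.chineseRemainder hco (x : ZMod (p i)).val 1
  have ha1' : (a : ZMod (p i)) = x := by
    rw [(ZMod.natCast_eq_natCast_iff _ _ _).mpr ha1, ZMod.natCast_zmod_val]
  have ha2' : (a : ZMod m) = 1 := by
    rw [(ZMod.natCast_eq_natCast_iff _ _ _).mpr ha2, Nat.cast_one]
  have hca : a.Coprime (∏ j, p j) := by
    rw [hm]
    refine Nat.Coprime.mul_right ?_ ?_
    · rw [← ZMod.isUnit_iff_coprime, ha1']; exact x.isUnit
    · rw [← ZMod.isUnit_iff_coprime, ha2']; exact isUnit_one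
  refine ⟨ZMod.unitOfCoprime a hca, ?_, ?_⟩
  · ext; simp [ZMod.unitsMap, ha2']
  · rw [MonoidHom.finsetProd_apply, Finset.prod_eq_single i]
    · rw [MonoidHom.comp_apply]
      congr 1
      ext; simp [ZMod.unitsMap, ha1']
    · intro j _ hj
      rw [MonoidHom.comp_apply]
      convert map_one (f j)
      ext
      have : (a : ZMod (p j)) = 1 := by
        have := congrArg (ZMod.castHom (show p j ∣ m by
          rw [hpim]; exact Finset.dvd_prod_of_mem p (by simpa using hj)) (ZMod (p j))) ha2'
        rwa [map_natCast, map_one] at this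
      simp [ZMod.unitsMap, this]
    · simp

theorem stmt_7 (r : ℕ) (hr : 1 ≤ r) (p : Fin r → ℕ) (hinj : Function.Injective p)
    (hprime : ∀ i, (p i).Prime) (hmod : ∀ i, p i % 3 = 1) :
    ∃ (K : Type) (_ : Field K) (_ : NumberField K), IsGalois ℚ K ∧
      Nonempty ((K ≃ₐ[ℚ] K) ≃* Multiplicative (ZMod 3)) ∧
      ∀ ℓ : ℕ, ℓ.Prime → ((ℓ : ℤ) ∣ NumberField.discr K ↔ ∃ i, p i = ℓ) := by
  choose f hf using fun i ↦ exists_surjective_units_zmod_three (hprime i) (hmod i)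
  let n := ∏ j, p j
  have : NeZero n := ⟨Finset.prod_ne_zero_iff.mpr fun i _ ↦ (hprime i).ne_zero⟩
  obtain ⟨L, _, _, _⟩ : ∃ (L : Type) (_ : Field L) (_ : NumberField L),
      IsCyclotomicExtension {n} ℚ L :=
    ⟨CyclotomicField n ℚ, inferInstance, inferInstance, CyclotomicField.isCyclotomicExtension n ℚ⟩
  have : IsGalois ℚ L := IsCyclotomicExtension.isGalois {n} ℚ L
  let e := IsCyclotomicExtension.Rat.galEquivZMod n L
  let φ : (ZMod n)ˣ →* Multiplicative (ZMod 3) :=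
    ∏ j, (f j).comp (ZMod.unitsMap (Finset.dvd_prod_of_mem p (Finset.mem_univ j)))
  have hdvd i : n = p i * ∏ j ∈ Finset.univ.erase i, p j :=
    (Finset.mul_prod_erase _ _ (Finset.mem_univ i)).symm
  let ψ : Gal(L/ℚ) →* Multiplicative (ZMod 3) := φ.comp e.toMonoidHom
  have hψ : Function.Surjective ψ := by
    refine Function.Surjective.comp (g := φ) (fun y ↦ ?_) e.surjective
    obtain ⟨x, rfl⟩ := hf ⟨0, hr⟩ y
    obtain ⟨u, -, hu⟩ := exists_unit_prod_comp_unitsMap_eq p hinj hprime f ⟨0, hr⟩ (hdvd _) x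
    exact ⟨u, hu⟩
  let K := IntermediateField.fixedField ψ.ker
  have : IsGalois ℚ K := IsGalois.of_fixedField_normal_subgroup ψ.ker
  refine ⟨K, inferInstance, inferInstance, this,
    ⟨(IsGalois.normalAutEquivQuotient ψ.ker).symm.trans
      (QuotientGroup.quotientKerEquivOfSurjective ψ hψ)⟩, fun ℓ hℓ ↦ ⟨fun h ↦ ?_, ?_⟩⟩
  · have h' : (ℓ : ℤ) ∣ (n : ℤ) :=
      (Nat.prime_iff_prime_int.mp hℓ).dvd_of_dvd_pow
        ((h.trans (discr_dvd_discr K L)).trans (discr_cyclotomic_dvd_pow n L))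
    obtain ⟨i, -, hi⟩ := (hℓ.prime.dvd_finsetProd_iff p).mp (Int.natCast_dvd_natCast.mp h')
    exact ⟨i, ((Nat.prime_dvd_prime_iff_eq hℓ (hprime i)).mp hi).symm⟩
  · rintro ⟨i, rfl⟩
    by_contra hK
    have hp : Prime (p i : ℤ) := Nat.prime_iff_prime_int.mp (hprime i)
    have : (Ideal.span {(p i : ℤ)}).IsMaximal :=
      PrincipalIdealRing.isMaximal_of_irreducible hp.irreducible
    obtain ⟨P, hP, hPl⟩ := Ideal.exists_maximal_ideal_liesOver_of_isIntegral (S := 𝓞 L)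
      (Ideal.span {(p i : ℤ)})
    obtain ⟨x, hx⟩ := hf i (Multiplicative.ofAdd 1)
    obtain ⟨u, hu1, hu2⟩ := exists_unit_prod_comp_unitsMap_eq p hinj hprime f i (hdvd i) x
    have hm : ¬ p i ∣ ∏ j ∈ Finset.univ.erase i, p j := by
      rw [(hprime i).prime.dvd_finsetProd_iff]
      rintro ⟨j, hj, hij⟩
      exact Finset.ne_of_mem_erase hj
        (hinj ((Nat.prime_dvd_prime_iff_eq (hprime i) (hprime j)).mp hij)).symm
    have : NeZero (∏ j ∈ Finset.univ.erase i, p j) := ⟨fun h ↦ hm (h ▸ dvd_zero _)⟩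
    have hσ := galEquivZMod_symm_mem_inertia (hprime i) (hdvd i) hm L P hu1
    have := restrictNormal_eq_one_of_mem_inertia (hprime i) hK P hσ
    have hmem : e.symm u ∈ K.fixingSubgroup := by
      rw [← IntermediateField.restrictNormalHom_ker]; exact this
    rw [IntermediateField.fixingSubgroup_fixedField] at hmem
    have : φ u = 1 := by simpa [ψ] using hmem
    rw [show φ u = _ from hu2, hx] at this
    exact absurd this (by decide)
end

section
/- Let n ≥ 2 be an integer, let p be a prime number with p ∤ n, and let k be an integer with p ∤ k. Then there exists a Galois number field K/ℚ with cyclic Galois group of order n whose reduced discriminant is congruent to k modulo p. -/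
/-- The reduced discriminant of a number field: the product of the distinct prime
numbers dividing its discriminant (equivalently, the ramified primes). -/
noncomputable def reducedDiscr (K : Type*) [Field K] [NumberField K] : ℕ :=
  ∏ q ∈ (NumberField.discr K).natAbs.primeFactors, q

theorem exists_prime_modEq_one_and_modEq {n p : ℕ} (hn : n ≠ 0) (hp : p.Prime) (hpn : ¬ p ∣ n)
    {k : ℤ} (hk : ¬ ((p : ℤ) ∣ k)) :
    ∃ q : ℕ, q.Prime ∧ q ≡ 1 [MOD n] ∧ (q : ℤ) ≡ k [ZMOD (p : ℤ)] := by
  have hcop : n.Coprime p := ((Nat.Prime.coprime_iff_not_dvd hp).2 hpn).symm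
  have hkmod : ((k % p).toNat : ℤ) ≡ k [ZMOD (p : ℤ)] := by
    rw [Int.toNat_of_nonneg (Int.emod_nonneg _ (by exact_mod_cast hp.ne_zero))]
    exact Int.mod_modEq k p
  obtain ⟨a, ha1, hak⟩ := Nat.chineseRemainder hcop 1 (k % p).toNat
  have hak' : (a : ℤ) ≡ k [ZMOD (p : ℤ)] := (Int.natCast_modEq_iff.2 hak).trans hkmod
  have han : a.Coprime n := by
    rw [Nat.Coprime, Nat.ModEq.gcd_eq ha1, Nat.gcd_one_left]
  have hap : a.Coprime p := by
    refine ((Nat.Prime.coprime_iff_not_dvd hp).2 fun h => hk ?_).symm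
    exact hak'.dvd_iff.1 (Int.natCast_dvd_natCast.2 h)
  obtain ⟨q, -, hq, hqa⟩ := Nat.forall_exists_prime_gt_and_modEq 0
    (mul_ne_zero hn hp.ne_zero) (han.mul_right hap)
  exact ⟨q, hq, (hqa.of_mul_right p).trans ha1,
    (Int.natCast_modEq_iff.2 (hqa.of_mul_left n)).trans hak'⟩

theorem reducedDiscr_eq_of_discr_dvd_prime_pow (K : Type*) [Field K] [NumberField K] {q m : ℕ}
    (hq : q.Prime) (hK : 1 < Module.finrank ℚ K)
    (h : (NumberField.discr K).natAbs ∣ q ^ m) : reducedDiscr K = q := by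
  have hgt := NumberField.abs_discr_gt_two hK
  obtain ⟨j, -, hj⟩ := (Nat.dvd_prime_pow hq).1 h
  have hj0 : j ≠ 0 := by
    rintro rfl
    rw [pow_zero] at hj
    rw [Int.abs_eq_natAbs, hj] at hgt
    norm_num at hgt
  rw [reducedDiscr, hj, Nat.primeFactors_prime_pow hj0 hq, Finset.prod_singleton]

theorem IsCyclic.exists_subgroup_index_eq {G : Type*} [CommGroup G] [Finite G] [IsCyclic G]
    {n : ℕ} (h : n ∣ Nat.card G) : ∃ H : Subgroup G, H.index = n :=
  ⟨(powMonoidHom n : G →* G).range, by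
    rw [IsCyclic.index_powMonoidHom_range, Nat.gcd_eq_right h]⟩

theorem stmt_9 (n : ℕ) (hn : 2 ≤ n) (p : ℕ) (hp : p.Prime) (hpn : ¬ p ∣ n)
    (k : ℤ) (hk : ¬ ((p : ℤ) ∣ k)) :
    ∃ (K : Type) (_ : Field K) (_ : NumberField K), IsGalois ℚ K ∧
      IsCyclic (K ≃ₐ[ℚ] K) ∧ Nat.card (K ≃ₐ[ℚ] K) = n ∧
      (reducedDiscr K : ℤ) ≡ k [ZMOD (p : ℤ)] := by
  obtain ⟨q, hq, hqn, hqk⟩ := exists_prime_modEq_one_and_modEq (by omega) hp hpn hk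
  have : Fact q.Prime := ⟨hq⟩
  let L := CyclotomicField q ℚ
  have : IsCyclotomicExtension {q} ℚ L := CyclotomicField.isCyclotomicExtension q ℚ
  have : IsGalois ℚ L := IsCyclotomicExtension.isGalois {q} ℚ L
  let e : Gal(L/ℚ) ≃* (ZMod q)ˣ := IsCyclotomicExtension.Rat.galEquivZMod q L
  have hcyc : IsCyclic Gal(L/ℚ) := isCyclic_of_surjective e.symm e.symm.surjective
  have hdvd : n ∣ Nat.card (ZMod q)ˣ := by
    rw [Nat.card_eq_fintype_card, ZMod.card_units]
    exact (Nat.modEq_iff_dvd' hq.one_le).1 hqn.symm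
  obtain ⟨H₀, hH₀⟩ := IsCyclic.exists_subgroup_index_eq hdvd
  let H : Subgroup Gal(L/ℚ) := H₀.comap e.toMonoidHom
  let K := IntermediateField.fixedField H
  have hgal : IsGalois ℚ K := IsGalois.of_fixedField_normal_subgroup H
  have hcard : Nat.card Gal(K/ℚ) = n := by
    refine (Nat.card_congr (IsGalois.normalAutEquivQuotient H).toEquiv).symm.trans ?_
    exact (Subgroup.index_comap_of_surjective H₀ e.surjective).trans hH₀
  refine ⟨K, inferInstance, inferInstance, hgal, ?_, hcard, ?_⟩
  · exact isCyclic_of_surjective (AlgEquiv.restrictNormalHom K : Gal(L/ℚ) →* Gal(K/ℚ))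
      (AlgEquiv.restrictNormalHom_surjective L)
  · have hrank : 1 < Module.finrank ℚ K := by
      rw [← IsGalois.card_aut_eq_finrank, hcard]
      exact hn
    have hdiscr : (NumberField.discr K).natAbs ∣ q ^ (q - 2) := by
      have h := Int.natAbs_dvd_natAbs.2 (NumberField.discr_dvd_discr K L)
      rw [IsCyclotomicExtension.Rat.discr_prime q L] at h
      simpa [Int.natAbs_mul, Int.natAbs_pow] using h
    rwa [reducedDiscr_eq_of_discr_dvd_prime_pow K hq hrank hdiscr]
end

section
/- Let K/ℚ be a Galois number field whose Galois group is cyclic of order 3. If ℓ is a prime number dividing the discriminant of K and ℓ ≠ 3, then ℓ ≡ 1 (mod 3). In other words, only the prime 3 and primes congruent to 1 modulo 3 can ramify in a C₃-extension of ℚ. -/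
theorem Ideal.map_le_sq_of_ramificationIdx_ne_one {S : Type*} [CommRing S] [IsDedekindDomain S]
    [CharZero S] [Module.Finite ℤ S] (p : Ideal ℤ) (hp : p ≠ ⊥) (P : Ideal S) [P.IsPrime]
    [P.LiesOver p] (h : P.ramificationIdx ℤ ≠ 1) :
    p.map (algebraMap ℤ S) ≤ P ^ 2 := by
  rw [← Ideal.ramificationIdx'_eq_ramificationIdx p P hp] at h
  exact (Ideal.ramificationIdx'_ne_one_iff (Ideal.map_le_of_le_comap (P.over_def p).le)).mp h

/-- A primitive third root of unity in a finite field forces its cardinality to be `1` mod `3`. -/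
theorem three_dvd_card_sub_one_of_root {F : Type*} [Field F] [Finite F] (h3 : (3 : F) ≠ 0)
    (a : F) (ha : 1 + a + a ^ 2 = 0) : 3 ∣ Nat.card F - 1 := by
  have := Fintype.ofFinite F
  have ha3 : a ^ 3 = 1 := by linear_combination (a - 1) * ha
  have ha1 : a ≠ 1 := by
    rintro rfl
    exact h3 (by linear_combination ha)
  have ha0 : a ≠ 0 := by
    rintro rfl
    simp at ha
  have := Fact.mk Nat.prime_three
  rw [← orderOf_eq_prime ha3 ha1, Nat.card_eq_fintype_card]
  exact orderOf_dvd_of_pow_eq_one (FiniteField.pow_card_sub_one_eq_one a ha0)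

/-- If `σ` generates the inertia action of order three at `P`, and `P` is ramified over `ℤ`, then
the trace of a uniformizer at `P` yields a root of `1 + X + X ^ 2` modulo `P`. -/
theorem Ideal.exists_one_add_add_sq_mem {S G : Type*} [CommRing S] [IsDedekindDomain S]
    [Group G] [MulSemiringAction G S] [IsGaloisGroup G ℤ S] (p : Ideal ℤ) (P : Ideal S)
    [P.IsPrime] [P.LiesOver p] (hP : P ≠ ⊥) (hpP : p.map (algebraMap ℤ S) ≤ P ^ 2) (σ : G)
    (hσ : ∀ x : S, σ • x - x ∈ P) (hσ3 : σ ^ 3 = 1) (hgen : Subgroup.zpowers σ = ⊤) :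
    ∃ a : S, 1 + a + a ^ 2 ∈ P := by
  obtain ⟨π, hπ, hπ2⟩ : ∃ x ∈ P, x ∉ P ^ 2 := by
    simpa using P.exists_mem_pow_notMem_pow_succ hP Ideal.IsPrime.ne_top' 1
  have hsmul {x : S} (hx : x ∈ P) : σ • x ∈ P := by simpa using P.add_mem (hσ x) hx
  have hPσ : P ≤ P.comap (MulSemiringAction.toRingHom G S σ) := fun _ hx ↦ hsmul hx
  have hsmul2 {x : S} (hx : x ∈ P ^ 2) : σ • x ∈ P ^ 2 := by
    have hle : (P ^ 2).map (MulSemiringAction.toRingHom G S σ) ≤ P ^ 2 := by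
      rw [Ideal.map_pow]
      exact Ideal.pow_right_mono (Ideal.map_le_iff_le_comap.mpr hPσ) 2
    exact hle (Ideal.mem_map_of_mem _ hx)
  obtain ⟨a, e, he, hae⟩ := Ideal.exists_mul_add_mem_pow_succ (P := P) hP (i := 1) π (σ • π)
    (by simpa using hπ) hπ2 (by simpa using hsmul hπ)
  have hσσ : σ • σ • π = (σ • a) * (σ • π) + σ • e := by
    rw [← hae, smul_add, smul_mul', hae, mul_comm]
  set T := π + σ • π + σ • σ • π with hT
  have hσT : σ • T = T := by
    have : σ • σ • σ • π = π := by rw [← mul_smul, ← mul_smul, ← pow_three', hσ3, one_smul]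
    rw [hT, smul_add, smul_add, this]
    ring
  have hGT (g : G) : g • T = T := by
    have hle : Subgroup.zpowers σ ≤ MulAction.stabilizer G T := by
      rwa [Subgroup.zpowers_le, MulAction.mem_stabilizer_iff]
    exact hle (hgen ▸ Subgroup.mem_top g)
  have hTP : T ∈ P := P.add_mem (P.add_mem hπ (hsmul hπ)) (hsmul (hsmul hπ))
  obtain ⟨n, hn⟩ := Algebra.IsInvariant.isInvariant (A := ℤ) (G := G) T hGT
  have hT2 : T ∈ P ^ 2 := by
    rw [← hn] at hTP ⊢
    refine hpP (Ideal.mem_map_of_mem _ ?_)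
    rwa [P.over_def p, Ideal.mem_comap]
  refine ⟨a, ?_⟩
  have hdiff : (σ • a - a) * (a * π) ∈ P ^ 2 := by
    rw [pow_two]
    exact Ideal.mul_mem_mul (hσ a) (P.mul_mem_left a hπ)
  have key : π * (1 + a + a ^ 2) ∈ P ^ 2 := by
    have : π * (1 + a + a ^ 2) =
        T - (σ • a - a) * (a * π) - (e + (σ • a) * e + σ • e) := by
      rw [hT, hσσ, ← hae]
      ring
    rw [this]
    exact Ideal.sub_mem _ (Ideal.sub_mem _ hT2 hdiff)
      (Ideal.add_mem _ (Ideal.add_mem _ he (Ideal.mul_mem_left _ _ he)) (hsmul2 he))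
  exact Ideal.mem_prime_of_mul_mem_pow hP hπ2 key

theorem stmt_10 (K : Type) [Field K] [NumberField K] [IsGalois ℚ K]
    (hcyc : IsCyclic (K ≃ₐ[ℚ] K)) (hcard : Nat.card (K ≃ₐ[ℚ] K) = 3)
    (ℓ : ℕ) (hℓ : ℓ.Prime) (hdvd : (ℓ : ℤ) ∣ NumberField.discr K) (hne : ℓ ≠ 3) :
    ℓ % 3 = 1 := by
  have hℓ' : Prime (ℓ : ℤ) := Nat.prime_iff_prime_int.mp hℓ
  obtain ⟨P, hPmax, hPover, hram⟩ : ∃ (P : Ideal (NumberField.RingOfIntegers K)) (_ : P.IsMaximal),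
      P.LiesOver (.span {(ℓ : ℤ)}) ∧ ¬ Algebra.IsUnramifiedAt ℤ P := by
    have := (NumberField.not_dvd_discr_iff_forall_liesOver K
      (NumberField.RingOfIntegers K) hℓ').not.mp (not_not.mpr hdvd)
    push Not at this
    obtain ⟨P, h1, h2, h3⟩ := this
    exact ⟨P, h1, h2, h3⟩
  set p : Ideal ℤ := .span {(ℓ : ℤ)} with hp
  have hp0 : p ≠ ⊥ := by simpa [hp] using hℓ.ne_zero
  have hpprime : p.IsPrime := (Ideal.span_singleton_prime hℓ'.ne_zero).mpr hℓ'
  have hpmax : p.IsMaximal := hpprime.isMaximal hp0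
  have hP0 : P ≠ ⊥ := Ideal.ne_bot_of_liesOver_of_ne_bot hp0 P
  have he : P.ramificationIdx ℤ ≠ 1 := fun h ↦ hram (Ideal.ramificationIdx_eq_one_iff.mp h)
  have hinertia : Nat.card (P.inertia (K ≃ₐ[ℚ] K)) = 3 := by
    have h1 : Nat.card (P.inertia (K ≃ₐ[ℚ] K)) ≠ 1 := by
      rwa [Ideal.card_inertia_eq_ramificationIdxIn p P,
        Ideal.ramificationIdxIn_eq_ramificationIdx p P (K ≃ₐ[ℚ] K)]
    have h2 := Subgroup.card_subgroup_dvd_card (P.inertia (K ≃ₐ[ℚ] K))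
    rw [hcard] at h2
    exact ((Nat.dvd_prime Nat.prime_three).mp h2).resolve_left h1
  have hf : P.inertiaDeg ℤ = 1 := by
    have h := Ideal.ncard_primesOver_mul_card_inertia_mul_finrank (G := K ≃ₐ[ℚ] K) p P
    rw [hinertia, hcard] at h
    exact Nat.eq_one_of_mul_eq_one_left (m := (p.primesOver _).ncard) (by linarith)
  have htop : P.inertia (K ≃ₐ[ℚ] K) = ⊤ :=
    Subgroup.eq_top_of_card_eq _ (hinertia.trans hcard.symm)
  obtain ⟨σ, hσ⟩ := hcyc.exists_generator
  obtain ⟨a, ha⟩ := Ideal.exists_one_add_add_sq_mem p P hP0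
    (Ideal.map_le_sq_of_ramificationIdx_ne_one p hp0 P he) σ
    (AddSubgroup.mem_inertia.mp (htop ▸ Subgroup.mem_top σ)) (hcard ▸ pow_card_eq_one')
    ((Subgroup.eq_top_iff' _).mpr hσ)
  have hnorm : Nat.card (NumberField.RingOfIntegers K ⧸ P) = ℓ := by
    have := Ideal.natAbs_pow_inertiaDeg (ℓ : ℤ) P
    rw [hf] at this
    simpa [Ideal.absNorm_apply, Submodule.cardQuot_apply] using this.symm
  let := Ideal.Quotient.field P
  have : Finite (NumberField.RingOfIntegers K ⧸ P) :=
    Nat.finite_of_card_ne_zero (hnorm ▸ hℓ.ne_zero)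
  have h3 : (3 : NumberField.RingOfIntegers K ⧸ P) ≠ 0 := by
    intro h
    have hmem : (3 : ℤ) ∈ p := by
      rw [P.over_def p, Ideal.mem_comap, ← Ideal.Quotient.eq_zero_iff_mem]
      simpa only [algebraMap_int_eq, eq_intCast, Int.cast_ofNat, map_ofNat] using h
    rw [hp, Ideal.mem_span_singleton] at hmem
    exact hne ((Nat.prime_dvd_prime_iff_eq hℓ Nat.prime_three).mp (by exact_mod_cast hmem))
  have := three_dvd_card_sub_one_of_root h3 (Ideal.Quotient.mk P a)
    (by simpa using Ideal.Quotient.eq_zero_iff_mem.mpr ha)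
  rw [hnorm] at this
  have := hℓ.two_le
  omega
end
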